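/- arXiv:math/0301054 — 6 statements merged into one kernel-verified Lean document; each statement's English description precedes it below -/
import Mathlib

section
/- (Kloeden's lemma, part 1.) Let T(x,y) = (f(x), g(x,y)) be a continuous triangular map on I × I, let P = {x₀, x₁, …, x_{p−1}} be a periodic orbit of f of minimal period p (with f(x_i) = x_{i+1} indices mod p), and let y₀ be a periodic point of g_P of minimal period q. Then (x₀, y₀) is a periodic point of T of minimal period exactly p·q, and the T-orbit of (x₀, y₀) is the set P·Q = {(x_j, t_{ip+j}) : 0 ≤ j ≤ p−1, 0 ≤ i ≤ q−1} of cardinality pq, where t_{ip} = g_P^i(y₀) and t_{ip+j} = g(x_{j−1}, t_{ip+j−1}) for j = 1,…,p−1. -/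
open Function

/-- The unit interval `[0,1]`. -/
local notation "I" => unitInterval

/-- The triangular map `T(x,y) = (f x, g (x,y))` on `I × I`. -/
def triMap (f : I → I) (g : I × I → I) : I × I → I × I :=
  fun z => (f z.1, g z)

/-- Given the fiber map `g` and points `x 0, …, x (p-1)`, the map
`g_P(y) = g(x_{p-1}, g(x_{p-2}, …, g(x₁, g(x₀, y))…))`. -/
def fiberComp (g : I × I → I) (p : ℕ) (x : ℕ → I) (y : I) : I :=
  (List.range p).foldl (fun z i => g (x i, z)) y

/-- `z` is a periodic point of `F` of minimal period `n`:
`F^[n] z = z` and `F^[k] z ≠ z` for `0 < k < n`. -/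
def MinPeriod {X : Type*} (F : X → X) (z : X) (n : ℕ) : Prop :=
  0 < n ∧ F^[n] z = z ∧ ∀ k, 0 < k → k < n → F^[k] z ≠ z

/-- The points `t_{ip+j}`:  `t_{ip} = g_P^[i] y₀` and
`t_{ip+j} = g (x_{j-1}, t_{ip+j-1})` for `j = 1, …, p-1`. -/
def tPt (g : I × I → I) (p : ℕ) (x : ℕ → I) (y₀ : I) (i j : ℕ) : I :=
  (List.range j).foldl (fun z l => g (x l, z)) ((fiberComp g p x)^[i] y₀)

theorem minPeriod_iff_minimalPeriod {X : Type*} {F : X → X} {z : X} {n : ℕ} :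
    MinPeriod F z n ↔ 0 < n ∧ minimalPeriod F z = n := by
  constructor
  · rintro ⟨hn, hz, hmin⟩
    have hper : IsPeriodicPt F n z := hz
    refine ⟨hn, (hper.minimalPeriod_le hn).eq_of_not_lt fun hlt => ?_⟩
    exact hmin _ (hper.minimalPeriod_pos hn) hlt (isPeriodicPt_minimalPeriod F z)
  · rintro ⟨hn, rfl⟩
    exact ⟨hn, isPeriodicPt_minimalPeriod F z, fun k hk hlt hkz =>
      (IsPeriodicPt.minimalPeriod_le hk hkz).not_gt hlt⟩

theorem fst_iterate_triMap (f : I → I) (g : I × I → I) (n : ℕ) (z : I × I) :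
    ((triMap f g)^[n] z).1 = f^[n] z.1 := by
  induction n with
  | zero => rfl
  | succ n ih => rw [iterate_succ_apply', iterate_succ_apply', ← ih]; rfl

/-- Iterating `triMap` along an initial segment of an `f`-orbit composes the fiber maps. -/
theorem iterate_triMap_eq_foldl (f : I → I) (g : I × I → I) (x : ℕ → I) (y : I) (n : ℕ)
    (hx : ∀ j < n, f^[j] (x 0) = x j) :
    (triMap f g)^[n] (x 0, y) =
      (f^[n] (x 0), (List.range n).foldl (fun z l => g (x l, z)) y) := by
  induction n with
  | zero => rfl
  | succ n ih =>
    rw [iterate_succ_apply', ih fun j hj => hx j (by omega), iterate_succ_apply',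
      hx n (by omega), List.range_succ, List.foldl_append]
    rfl

theorem iterate_mul_triMap (f : I → I) (g : I × I → I) (p : ℕ) (x : ℕ → I) (y : I)
    (hx : ∀ j < p, f^[j] (x 0) = x j) (hp : f^[p] (x 0) = x 0) (i : ℕ) :
    (triMap f g)^[p * i] (x 0, y) = (x 0, (fiberComp g p x)^[i] y) := by
  induction i with
  | zero => rfl
  | succ i ih =>
    rw [Nat.mul_succ, Nat.add_comm, iterate_add_apply, ih, iterate_triMap_eq_foldl f g x _ p hx,
      hp, iterate_succ_apply']
    rfl

theorem iterate_mul_add_triMap (f : I → I) (g : I × I → I) (p : ℕ) (x : ℕ → I) (y : I)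
    (hx : ∀ j < p, f^[j] (x 0) = x j) (hp : f^[p] (x 0) = x 0) (i : ℕ) {j : ℕ} (hj : j < p) :
    (triMap f g)^[p * i + j] (x 0, y) = (x j, tPt g p x y i j) := by
  rw [Nat.add_comm, iterate_add_apply, iterate_mul_triMap f g p x y hx hp,
    iterate_triMap_eq_foldl f g x _ j fun l hl => hx l (hl.trans hj), hx j hj]
  rfl

theorem minimalPeriod_triMap (f : I → I) (g : I × I → I) (x : ℕ → I) (y : I)
    (hx : ∀ j < minimalPeriod f (x 0), f^[j] (x 0) = x j) :
    minimalPeriod (triMap f g) (x 0, y) =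
      minimalPeriod f (x 0) * minimalPeriod (fiberComp g (minimalPeriod f (x 0)) x) y := by
  have hmul := iterate_mul_triMap f g _ x y hx (isPeriodicPt_minimalPeriod f (x 0))
  apply Nat.dvd_antisymm
  · apply IsPeriodicPt.minimalPeriod_dvd
    rw [IsPeriodicPt, IsFixedPt, hmul, iterate_minimalPeriod]
  · have hT := isPeriodicPt_minimalPeriod (triMap f g) (x 0, y)
    generalize minimalPeriod (triMap f g) (x 0, y) = n at hT ⊢
    obtain ⟨i, rfl⟩ : minimalPeriod f (x 0) ∣ n := by
      apply IsPeriodicPt.minimalPeriod_dvd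
      exact (fst_iterate_triMap f g n (x 0, y)).symm.trans (congrArg Prod.fst hT)
    apply Nat.mul_dvd_mul_left
    apply IsPeriodicPt.minimalPeriod_dvd
    exact congrArg Prod.snd ((hmul i).symm.trans hT)

/-- Kloeden's lemma, part 1: if `P = {x 0, …, x (p-1)}` is a periodic orbit of `f` of
minimal period `p` and `y₀` is a periodic point of `g_P` of minimal period `q`, then
`(x 0, y₀)` is a periodic point of `T` of minimal period exactly `p*q`, and its `T`-orbit
is the set `P·Q = {(x j, t_{ip+j}) : 0 ≤ j ≤ p-1, 0 ≤ i ≤ q-1}`, of cardinality `p*q`. -/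
theorem triMap_product_orbit (f : I → I) (g : I × I → I)
    (hf : Continuous f) (hg : Continuous g)
    (p q : ℕ) (x : ℕ → I) (y₀ : I)
    (horb : ∀ i, i < p - 1 → f (x i) = x (i + 1))
    (hlast : f (x (p - 1)) = x 0)
    (hpmin : MinPeriod f (x 0) p)
    (hqmin : MinPeriod (fiberComp g p x) y₀ q) :
    MinPeriod (triMap f g) (x 0, y₀) (p * q) ∧
    Set.range (fun n : ℕ => (triMap f g)^[n] (x 0, y₀)) =
      {w : I × I | ∃ j < p, ∃ i < q, w = (x j, tPt g p x y₀ i j)} ∧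
    ({w : I × I | ∃ j < p, ∃ i < q, w = (x j, tPt g p x y₀ i j)}).ncard = p * q := by
  obtain ⟨hp, hpf⟩ := minPeriod_iff_minimalPeriod.1 hpmin
  obtain ⟨hq, hqg⟩ := minPeriod_iff_minimalPeriod.1 hqmin
  have hx : ∀ j < p, f^[j] (x 0) = x j := by
    intro j
    induction j with
    | zero => intro _; rfl
    | succ j ih =>
      intro hj
      rw [iterate_succ_apply', ih (by omega), horb j (by omega)]
  have hT : minimalPeriod (triMap f g) (x 0, y₀) = p * q := by
    subst hpf
    rw [minimalPeriod_triMap f g x y₀ hx, hqg]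
  have hpq : 0 < p * q := Nat.mul_pos hp hq
  have hiter := fun i j => iterate_mul_add_triMap f g p x y₀ hx hpmin.2.1 i (j := j)
  have hset : {w : I × I | ∃ j < p, ∃ i < q, w = (x j, tPt g p x y₀ i j)} =
      (fun n : ℕ => (triMap f g)^[n] (x 0, y₀)) '' Set.Iio (p * q) := by
    ext w
    constructor
    · rintro ⟨j, hj, i, hi, rfl⟩
      refine ⟨p * i + j, ?_, hiter i j hj⟩
      have := Nat.mul_le_mul_left p (Nat.succ_le_of_lt hi)
      rw [Nat.mul_succ] at this
      rw [Set.mem_Iio]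
      omega
    · rintro ⟨n, hn, rfl⟩
      refine ⟨n % p, Nat.mod_lt n hp, n / p, Nat.div_lt_of_lt_mul hn, ?_⟩
      rw [← hiter _ _ (Nat.mod_lt n hp), Nat.div_add_mod]
  refine ⟨minPeriod_iff_minimalPeriod.2 ⟨hpq, hT⟩, ?_, ?_⟩
  · rw [hset]
    refine Set.Subset.antisymm ?_ (Set.image_subset_range _ _)
    rintro _ ⟨n, rfl⟩
    refine ⟨n % (p * q), Nat.mod_lt n hpq, ?_⟩
    simp only [← hT, iterate_mod_minimalPeriod_eq]
  · have hinj : Set.InjOn (fun n : ℕ => (triMap f g)^[n] (x 0, y₀)) (Set.Iio (p * q)) :=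
      hT ▸ iterate_injOn_Iio_minimalPeriod
    rw [hset, hinj.ncard_image, ← Finset.coe_Iio, Set.ncard_coe_finset, Nat.card_Iio]
end

section
/- (Kloeden's lemma, part 2.) Let T(x,y) = (f(x), g(x,y)) be a continuous triangular map on I × I and let (x, y) be a periodic point of T of minimal period n. Let p be the minimal period of x under f and let P = {x, f(x), …, f^{p−1}(x)} be the f-orbit of x, listed starting at x₀ = x. Then p divides n, and y is a periodic point of g_P of minimal period exactly n/p. -/
open Function

/-- The unit interval `[0,1]`. -/
local notation "I" => unitInterval

/-- The `k`-th iterate of a triangular map is the pair of the `k`-th iterate of the basis map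
and the fiber composition along the first `k` points of the orbit. -/
theorem triMap_iterate (f : I → I) (g : I × I → I) (x y : I) (k : ℕ) :
    (triMap f g)^[k] (x, y) = (f^[k] x, fiberComp g k (fun i => f^[i] x) y) := by
  induction k with
  | zero => simp [fiberComp]
  | succ k ih =>
    rw [iterate_succ_apply', ih]
    simp [triMap, fiberComp, List.range_succ, iterate_succ_apply']

/-- Along a `p`-periodic base point, iterating `T^[p]` iterates the fiber composition. -/
theorem triMap_iterate_mul (f : I → I) (g : I × I → I) {x : I} {p : ℕ}
    (hx : f^[p] x = x) (y : I) (m : ℕ) :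
    (triMap f g)^[p * m] (x, y) = (x, (fiberComp g p (fun i => f^[i] x))^[m] y) := by
  induction m with
  | zero => simp
  | succ m ih =>
    rw [Nat.mul_succ, Nat.add_comm, iterate_add_apply, ih, triMap_iterate, hx,
      iterate_succ_apply']

theorem MinPeriod.dvd {X : Type*} {F : X → X} {z : X} {p n : ℕ} (h : MinPeriod F z p)
    (hn : F^[n] z = z) : p ∣ n := by
  obtain ⟨hpos, hper, hmin⟩ := h
  by_contra hdvd
  refine hmin (n % p) (Nat.pos_of_ne_zero fun h0 => hdvd (Nat.dvd_of_mod_eq_zero h0))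
    (Nat.mod_lt n hpos) ?_
  have hp : IsPeriodicPt F p z := hper
  rw [hp.iterate_mod_apply, hn]

/-- Kloeden's lemma, part 2: if `(x, y)` is a periodic point of the triangular map `T`
of minimal period `n`, and `p` is the minimal period of `x` under `f`, with
`P = {x, f x, …, f^[p-1] x}` the `f`-orbit of `x` listed starting at `x`, then `p ∣ n`
and `y` is a periodic point of `g_P` of minimal period exactly `n / p`. -/
theorem triMap_periodic_point_decomposition (f : I → I) (g : I × I → I)
    (hf : Continuous f) (hg : Continuous g)
    (x y : I) (n p : ℕ)
    (hn : MinPeriod (triMap f g) (x, y) n)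
    (hp : MinPeriod f x p) :
    p ∣ n ∧ MinPeriod (fiberComp g p (fun i => f^[i] x)) y (n / p) := by
  have hfn : f^[n] x = x := by
    have h := hn.2.1
    rw [triMap_iterate] at h
    exact congrArg Prod.fst h
  obtain ⟨m, rfl⟩ := hp.dvd hfn
  obtain ⟨hpos, hper, hmin⟩ := hn
  rw [Nat.mul_div_cancel_left m hp.1]
  rw [triMap_iterate_mul f g hp.2.1] at hper
  refine ⟨Nat.dvd_mul_right p m, Nat.pos_of_mul_pos_left hpos, congrArg Prod.snd hper, ?_⟩
  intro k hk hkm h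
  refine hmin (p * k) (Nat.mul_pos hp.1 hk) (Nat.mul_lt_mul_of_pos_left hkm hp.1) ?_
  rw [triMap_iterate_mul f g hp.2.1, h]
end

section
/- (Kloeden: realization of Sharkovsky types by triangular maps.) For every positive integer m there exists a continuous triangular map T on I × I whose set of minimal periods of periodic points is exactly S(m) = {m} ∪ {k : m >_s k}, i.e. T is of type m. -/
open Function

/-- The unit interval `[0,1]`. -/
local notation "I" => unitInterval

/-- The Sharkovsky ordering: writing `m = 2^a * m'` and `k = 2^c * k'` with `m', k'` odd,
`m >_s k` iff (i) `m' > 1`, `k' > 1` and (`a < c`, or `a = c` and `m' < k'`); or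
(ii) `m' > 1` and `k' = 1`; or (iii) `m' = k' = 1` and `a > c`. -/
def SharkGt (m k : ℕ) : Prop :=
  ∃ a m' c k' : ℕ, Odd m' ∧ Odd k' ∧ m = 2 ^ a * m' ∧ k = 2 ^ c * k' ∧
    ((1 < m' ∧ 1 < k' ∧ (a < c ∨ (a = c ∧ m' < k'))) ∨
     (1 < m' ∧ k' = 1) ∨
     (m' = 1 ∧ k' = 1 ∧ c < a))

/-- The set of minimal periods of periodic points of `F`. -/
def periodSet {X : Type*} (F : X → X) : Set ℕ := {k | ∃ z, MinPeriod F z k}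

theorem minPeriod_iff {X : Type*} {F : X → X} {z : X} {k : ℕ} :
    MinPeriod F z k ↔ 0 < k ∧ minimalPeriod F z = k := by
  constructor
  · rintro ⟨hk, hz, hmin⟩
    refine ⟨hk, le_antisymm (IsPeriodicPt.minimalPeriod_le hk hz) ?_⟩
    by_contra! hlt
    exact hmin _ (IsPeriodicPt.minimalPeriod_pos hk hz) hlt (iterate_minimalPeriod)
  · rintro ⟨hk, rfl⟩
    exact ⟨hk, iterate_minimalPeriod,
      fun i hi hlt => not_isPeriodicPt_of_pos_of_lt_minimalPeriod hi.ne' hlt⟩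

theorem MinPeriod.iterate {X : Type*} {F : X → X} {z : X} {k : ℕ} (h : MinPeriod F z k) (i : ℕ) :
    MinPeriod F (F^[i] z) k := by
  rw [minPeriod_iff] at h ⊢
  refine ⟨h.1, ?_⟩
  rw [minimalPeriod_apply_iterate (minimalPeriod_pos_iff_mem_periodicPts.1 (h.2 ▸ h.1)), h.2]

theorem MinPeriod.mem_range {X : Type*} {F : X → X} {z : X} {k : ℕ} (h : MinPeriod F z k) :
    ∃ w, F w = z := by
  refine ⟨F^[k - 1] z, ?_⟩
  rw [← iterate_succ_apply' F, Nat.succ_eq_add_one, Nat.sub_add_cancel h.1, h.2.1]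

theorem MinPeriod.eq_one_of_isFixedPt {X : Type*} {F : X → X} {z : X} {k : ℕ}
    (h : MinPeriod F z k) (hz : F z = z) : k = 1 := by
  by_contra hk
  exact h.2.2 1 one_pos (by have := h.1; omega) hz

theorem minPeriod_one {X : Type*} {F : X → X} {z : X} (hz : F z = z) : MinPeriod F z 1 :=
  ⟨one_pos, hz, fun i hi hlt => by omega⟩

theorem minPeriod_of_forall_lt {F : ℝ → ℝ} {x : ℝ} {k : ℕ} (hk : 0 < k) (hx : F^[k] x = x)
    (h : ∀ i, 0 < i → i < k → x < F^[i] x) : MinPeriod F x k :=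
  ⟨hk, hx, fun i hi hlt => (h i hi hlt).ne'⟩

theorem minPeriod_semiconj_iff {X Y : Type*} {F : X → X} {G : Y → Y} {e : X → Y}
    (he : Injective e) (h : Semiconj e F G) {x : X} {k : ℕ} :
    MinPeriod G (e x) k ↔ MinPeriod F x k := by
  have key : ∀ i, G^[i] (e x) = e x ↔ F^[i] x = x := fun i => by
    rw [← (h.iterate_right i).eq, he.eq_iff]
  simp only [MinPeriod, ne_eq, key]

theorem periodSet_eq_of_semiconj {X Y : Type*} {F : X → X} {G : Y → Y} {e : X → Y}
    (he : Injective e) (h : Semiconj e F G) (hrange : ∀ y, ∃ x, e x = G y) :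
    periodSet F = periodSet G := by
  ext k
  constructor
  · rintro ⟨x, hx⟩
    exact ⟨e x, (minPeriod_semiconj_iff he h).2 hx⟩
  · rintro ⟨y, hy⟩
    obtain ⟨w, rfl⟩ := hy.mem_range
    obtain ⟨x, hx⟩ := hrange w
    exact ⟨x, (minPeriod_semiconj_iff he h).1 (hx ▸ hy)⟩

/-- `P` is the set of minimal periods of a continuous map of the line with values in `[0,1]`. -/
def Realizable (P : Set ℕ) : Prop :=
  ∃ F : ℝ → ℝ, Continuous F ∧ (∀ x, F x ∈ Set.Icc (0 : ℝ) 1) ∧ periodSet F = P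

theorem realizable_periodSet {F : ℝ → ℝ} {a b : ℝ} (hab : a < b) (hF : Continuous F)
    (hFab : ∀ x, F x ∈ Set.Icc a b) : Realizable (periodSet F) := by
  have hd : 0 < b - a := sub_pos.2 hab
  refine ⟨fun x => (F (a + (b - a) * x) - a) / (b - a), by fun_prop, fun x => ?_, ?_⟩
  · obtain ⟨h1, h2⟩ := hFab (a + (b - a) * x)
    exact ⟨div_nonneg (by linarith) hd.le, (div_le_one hd).2 (by linarith)⟩
  · refine periodSet_eq_of_semiconj (e := fun x => a + (b - a) * x) ?_ ?_ ?_
    · intro x y hxy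
      simpa [hd.ne'] using hxy
    · intro x
      field_simp
      ring
    · intro y
      refine ⟨(F y - a) / (b - a), ?_⟩
      field_simp
      ring

theorem Realizable.exists_triMap {P : Set ℕ} (h : Realizable P) :
    ∃ (f : I → I) (g : I × I → I), Continuous f ∧ Continuous g ∧
      periodSet (triMap f g) = P := by
  obtain ⟨F, hF, hF01, rfl⟩ := h
  let f : I → I := fun t => ⟨F t, hF01 t⟩
  refine ⟨f, fun _ => 0, by fun_prop, continuous_const, ?_⟩
  have h1 : periodSet f = periodSet (triMap f fun _ => 0) :=
    periodSet_eq_of_semiconj (e := fun t => (t, 0))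
      (fun s t hst => congrArg Prod.fst hst) (fun t => rfl) fun y => ⟨f y.1, rfl⟩
  have h2 : periodSet f = periodSet F :=
    periodSet_eq_of_semiconj (e := fun t : I => (t : ℝ))
      Subtype.val_injective (fun t => rfl) fun y => ⟨⟨F y, hF01 y⟩, rfl⟩
  rw [← h1, h2]

theorem realizable_singleton_one : Realizable {1} := by
  refine ⟨fun _ => 0, continuous_const, fun x => by simp, ?_⟩
  ext k
  constructor
  · rintro ⟨x, hx⟩
    obtain ⟨w, rfl⟩ := hx.mem_range
    exact hx.eq_one_of_isFixedPt rfl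
  · rintro rfl
    exact ⟨0, minPeriod_one rfl⟩

/-! ### Period doubling -/

/-- The doubling of `F : ℝ → [0,1]`: it maps `[0,1]` into `[2,3]` by `F + 2`, maps `[2,3]` back
to `[0,1]` by translation, and is affine on `[1,2]`. -/
noncomputable def doubling (F : ℝ → ℝ) (x : ℝ) : ℝ :=
  (F (min x 1) + 2) * max 0 (min 1 (2 - x)) + max 0 (min 1 (x - 2))

section Doubling

variable {F : ℝ → ℝ}

theorem doubling_of_le_one {x : ℝ} (hx : x ≤ 1) : doubling F x = F x + 2 := by
  rw [doubling, min_eq_left hx, min_eq_left (by linarith : (1 : ℝ) ≤ 2 - x),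
    min_eq_right (by linarith : x - 2 ≤ 1), max_eq_right zero_le_one,
    max_eq_left (by linarith : x - 2 ≤ 0)]
  ring

theorem doubling_of_mem_Icc {x : ℝ} (h1 : 1 ≤ x) (h2 : x ≤ 2) :
    doubling F x = (F 1 + 2) * (2 - x) := by
  rw [doubling, min_eq_right h1, min_eq_right (by linarith : 2 - x ≤ 1),
    min_eq_right (by linarith : x - 2 ≤ 1), max_eq_right (by linarith : 0 ≤ 2 - x),
    max_eq_left (by linarith : x - 2 ≤ 0)]
  ring

theorem doubling_of_two_le {x : ℝ} (h2 : 2 ≤ x) : doubling F x = min 1 (x - 2) := by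
  rw [doubling, min_eq_right (by linarith : 2 - x ≤ 1), max_eq_left (by linarith : 2 - x ≤ 0),
    max_eq_right (le_min zero_le_one (by linarith) : 0 ≤ min 1 (x - 2))]
  ring

theorem doubling_mem_Icc (hF : ∀ x, F x ∈ Set.Icc (0 : ℝ) 1) (x : ℝ) :
    doubling F x ∈ Set.Icc (0 : ℝ) 3 := by
  rcases le_total x 1 with h1 | h1
  · rw [doubling_of_le_one h1]
    obtain ⟨h, h'⟩ := hF x
    constructor <;> linarith
  rcases le_total x 2 with h2 | h2
  · rw [doubling_of_mem_Icc h1 h2]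
    obtain ⟨h, h'⟩ := hF 1
    constructor <;> nlinarith
  · rw [doubling_of_two_le h2]
    exact ⟨le_min zero_le_one (by linarith), (min_le_left _ _).trans (by norm_num)⟩

theorem continuous_doubling (hF : Continuous F) : Continuous (doubling F) := by
  unfold doubling
  fun_prop

theorem doubling_iterate_two_mul (hF : ∀ x, F x ∈ Set.Icc (0 : ℝ) 1) {x : ℝ}
    (hx : x ∈ Set.Icc (0 : ℝ) 1) (i : ℕ) :
    (doubling F)^[2 * i] x = F^[i] x ∧ F^[i] x ∈ Set.Icc (0 : ℝ) 1 := by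
  induction i with
  | zero => exact ⟨rfl, hx⟩
  | succ i ih =>
    obtain ⟨h1, h2⟩ := ih
    obtain ⟨h3, h4⟩ := hF (F^[i] x)
    rw [mul_add_one, iterate_succ_apply', iterate_succ_apply', h1, doubling_of_le_one h2.2,
      doubling_of_two_le (by linarith), add_sub_cancel_right, min_eq_right h4,
      iterate_succ_apply']
    exact ⟨rfl, h3, h4⟩

theorem two_le_doubling_iterate (hF : ∀ x, F x ∈ Set.Icc (0 : ℝ) 1) {x : ℝ}
    (hx : x ∈ Set.Icc (0 : ℝ) 1) (i : ℕ) : 2 ≤ (doubling F)^[2 * i + 1] x := by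
  obtain ⟨h1, h2⟩ := doubling_iterate_two_mul hF hx i
  rw [iterate_succ_apply', h1, doubling_of_le_one h2.2]
  linarith [(hF (F^[i] x)).1]

theorem minPeriod_doubling_iff (hF : ∀ x, F x ∈ Set.Icc (0 : ℝ) 1) {x : ℝ}
    (hx : x ∈ Set.Icc (0 : ℝ) 1) {k : ℕ} :
    MinPeriod (doubling F) x k ↔ ∃ j, k = 2 * j ∧ MinPeriod F x j := by
  have heven := fun i => (doubling_iterate_two_mul hF hx i).1
  have hodd : ∀ i, (doubling F)^[2 * i + 1] x ≠ x := fun i h => by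
    linarith [two_le_doubling_iterate hF hx i, hx.2]
  constructor
  · rintro ⟨hk, hper, hmin⟩
    obtain ⟨j, rfl | rfl⟩ := Nat.even_or_odd' k
    · refine ⟨j, rfl, by omega, by rw [← heven, hper], fun i hi hlt => ?_⟩
      rw [← heven]
      exact hmin _ (by omega) (by omega)
    · exact absurd hper (hodd j)
  · rintro ⟨j, rfl, hj, hper, hmin⟩
    refine ⟨by omega, by rw [heven, hper], fun i hi hlt => ?_⟩
    obtain ⟨l, rfl | rfl⟩ := Nat.even_or_odd' i
    · rw [heven]
      exact hmin l (by omega) (by omega)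
    · exact hodd l

theorem periodSet_doubling (hF : ∀ x, F x ∈ Set.Icc (0 : ℝ) 1) :
    periodSet (doubling F) = {k | k = 1 ∨ ∃ j ∈ periodSet F, k = 2 * j} := by
  have hc := (hF 1).1
  have hc' := (hF 1).2
  obtain ⟨p, hp1, hp2, hp⟩ : ∃ p : ℝ, 1 ≤ p ∧ p ≤ 2 ∧ (F 1 + 2) * (2 - p) = p := by
    refine ⟨2 * (F 1 + 2) / (F 1 + 3), ?_, ?_, ?_⟩
    · rw [le_div_iff₀ (by linarith)]; linarith
    · rw [div_le_iff₀ (by linarith)]; linarith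
    · have : F 1 + 3 ≠ 0 := by linarith
      field_simp
      ring
  ext k
  constructor
  · rintro ⟨x, hx⟩
    by_cases hleft : ∃ i, (doubling F)^[i] x ∈ Set.Icc (0 : ℝ) 1
    · obtain ⟨i, hi⟩ := hleft
      obtain ⟨j, hj, hjF⟩ := (minPeriod_doubling_iff hF hi).1 (hx.iterate i)
      exact Or.inr ⟨j, ⟨_, hjF⟩, hj⟩
    push Not at hleft
    have hpos : ∀ i, 0 ≤ (doubling F)^[i + 1] x := fun i => by
      rw [iterate_succ_apply']
      exact (doubling_mem_Icc hF _).1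
    have hmid : ∀ i, 1 ≤ (doubling F)^[i + 1] x ∧ (doubling F)^[i + 1] x ≤ 2 := fun i => by
      constructor
      · by_contra! h
        exact hleft _ ⟨hpos i, h.le⟩
      · by_contra! h
        refine hleft (i + 1 + 1) ⟨hpos (i + 1), ?_⟩
        rw [iterate_succ_apply', doubling_of_two_le h.le]
        exact min_le_left _ _
    set y := (doubling F)^[1] x with hy
    have hyk : MinPeriod (doubling F) y k := hx.iterate 1
    have hlin : ∀ i, (doubling F)^[i] y - p = (-(F 1 + 2)) ^ i * (y - p) := fun i => by
      induction i with
      | zero => simp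
      | succ i ih =>
        have h := hmid i
        rw [iterate_add_apply, ← hy] at h
        rw [iterate_succ_apply', doubling_of_mem_Icc h.1 h.2, pow_succ]
        linear_combination (-(F 1 + 2)) * ih + hp
    have hyp : y = p := by
      by_contra hne
      have h := hlin k
      rw [hyk.2.1] at h
      have hone : (-(F 1 + 2)) ^ k = 1 :=
        mul_right_cancel₀ (sub_ne_zero.2 hne) (by rw [← h, one_mul])
      have habs := congrArg abs hone
      rw [abs_pow, abs_neg, abs_one, abs_of_pos (by linarith)] at habs
      exact (one_lt_pow₀ (by linarith : 1 < F 1 + 2) hyk.1.ne').ne' habs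
    refine Or.inl (hyk.eq_one_of_isFixedPt ?_)
    rw [hyp, doubling_of_mem_Icc hp1 hp2, hp]
  · rintro (rfl | ⟨j, ⟨x, hx⟩, rfl⟩)
    · exact ⟨p, minPeriod_one (by rw [doubling_of_mem_Icc hp1 hp2, hp])⟩
    · obtain ⟨w, hw⟩ := hx.mem_range
      exact ⟨x, (minPeriod_doubling_iff hF (hw ▸ hF w)).2 ⟨j, rfl, hx⟩⟩

theorem Realizable.doubling {P : Set ℕ} (h : Realizable P) :
    Realizable {k | k = 1 ∨ ∃ j ∈ P, k = 2 * j} := by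
  obtain ⟨F, hF, hF01, rfl⟩ := h
  rw [← periodSet_doubling hF01]
  exact realizable_periodSet (by norm_num) (continuous_doubling hF) (doubling_mem_Icc hF01)

end Doubling

/-! ### Odd periods -/

/-- The piecewise affine map of `[-n,n]` for which `0` has the orbit
`0 → 1 → -1 → 2 → -2 → ⋯ → n → -n → 0` of odd period `2 * n + 1`. -/
noncomputable def stefanMap (n : ℕ) (x : ℝ) : ℝ :=
  max (-n) (min (min (n * (x + n)) (1 - x)) (max (1 - 2 * x) (-x)))

section Stefan

variable {n : ℕ} {x : ℝ}

theorem stefanMap_of_le_one_sub (hn : 1 ≤ n) (h1 : -n ≤ x) (h2 : x ≤ 1 - n) :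
    stefanMap n x = n * (x + n) := by
  have hn' : (1 : ℝ) ≤ n := by exact_mod_cast hn
  rw [stefanMap, max_eq_left (a := 1 - 2 * x) (by linarith),
    min_eq_left (a := (n : ℝ) * (x + n)) (by nlinarith),
    min_eq_left (by nlinarith), max_eq_right (by nlinarith)]

theorem stefanMap_of_nonpos (hn : 1 ≤ n) (h1 : 1 - n ≤ x) (h2 : x ≤ 0) :
    stefanMap n x = 1 - x := by
  have hn' : (1 : ℝ) ≤ n := by exact_mod_cast hn
  rw [stefanMap, max_eq_left (a := 1 - 2 * x) (by linarith),
    min_eq_right (a := (n : ℝ) * (x + n)) (by nlinarith),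
    min_eq_left (by linarith), max_eq_right (by linarith)]

theorem stefanMap_of_mem_Icc (hn : 1 ≤ n) (h1 : 0 ≤ x) (h2 : x ≤ 1) :
    stefanMap n x = 1 - 2 * x := by
  have hn' : (1 : ℝ) ≤ n := by exact_mod_cast hn
  rw [stefanMap, max_eq_left (a := 1 - 2 * x) (by linarith),
    min_eq_right (a := (n : ℝ) * (x + n)) (by nlinarith),
    min_eq_right (by linarith), max_eq_right (by linarith)]

theorem stefanMap_of_one_le (h1 : 1 ≤ x) (h2 : x ≤ n) : stefanMap n x = -x := by
  rw [stefanMap, max_eq_right (a := 1 - 2 * x) (by linarith),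
    min_eq_right (a := (n : ℝ) * (x + n)) (by nlinarith),
    min_eq_right (by linarith), max_eq_right (by linarith)]

theorem continuous_stefanMap : Continuous (stefanMap n) := by
  unfold stefanMap
  fun_prop

theorem neg_le_stefanMap (n : ℕ) (x : ℝ) : -(n : ℝ) ≤ stefanMap n x := le_max_left _ _

theorem stefanMap_le (n : ℕ) (x : ℝ) : stefanMap n x ≤ n := by
  have hn : (0 : ℝ) ≤ n := n.cast_nonneg
  refine max_le (by linarith) ((min_le_left _ _).trans ?_)
  rcases le_total x (1 - n) with h | h
  · exact (min_le_left _ _).trans (by nlinarith)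
  · exact (min_le_right _ _).trans (by linarith)

theorem stefanMap_le_one_sub (h : x ≤ n) : stefanMap n x ≤ 1 - x :=
  max_le (by linarith) ((min_le_left _ _).trans (min_le_right _ _))

theorem neg_max_le_stefanMap (hn : 1 ≤ n) (h1 : -n ≤ x) (h2 : x ≤ n) :
    -max x 0 ≤ stefanMap n x := by
  have hn' : (1 : ℝ) ≤ n := by exact_mod_cast hn
  have hx := le_max_left x 0
  have h0 := le_max_right x 0
  rcases le_total x (1 - n) with h | h
  · rw [stefanMap_of_le_one_sub hn h1 h]; nlinarith
  rcases le_total x 0 with h' | h'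
  · rw [stefanMap_of_nonpos hn h h']; linarith
  rcases le_total x 1 with h'' | h''
  · rw [stefanMap_of_mem_Icc hn h' h'']; linarith
  · rw [stefanMap_of_one_le h'' h2]; linarith

theorem stefanMap_lt_third (hn : 1 ≤ n) (h : 1 / 3 < x) : stefanMap n x < 1 / 3 := by
  have hn' : (1 : ℝ) ≤ n := by exact_mod_cast hn
  exact max_lt (by linarith) ((min_le_right _ _).trans_lt (max_lt (by linarith) (by linarith)))

theorem le_of_stefanMap_lt_third (hn : 1 ≤ n) (h1 : -n ≤ x) (hx : x < 1 / 3)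
    (h : stefanMap n x < 1 / 3) : x ≤ 1 / 3 - n ∧ 0 ≤ stefanMap n x := by
  have hn' : (1 : ℝ) ≤ n := by exact_mod_cast hn
  rcases le_total x (1 - n) with h' | h'
  · rw [stefanMap_of_le_one_sub hn h1 h'] at h ⊢
    constructor <;> nlinarith
  rcases le_total x 0 with h0 | h0
  · rw [stefanMap_of_nonpos hn h' h0] at h; linarith
  · rw [stefanMap_of_mem_Icc hn h0 (by linarith)] at h; linarith

theorem stefanMap_mem_Icc (n : ℕ) (x : ℝ) : stefanMap n x ∈ Set.Icc (-n : ℝ) n :=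
  ⟨neg_le_stefanMap n x, stefanMap_le n x⟩

theorem stefanMap_iterate_mem_Icc (hx : x ∈ Set.Icc (-n : ℝ) n) (i : ℕ) :
    (stefanMap n)^[i] x ∈ Set.Icc (-n : ℝ) n := by
  cases i with
  | zero => exact hx
  | succ i => rw [iterate_succ_apply']; exact stefanMap_mem_Icc n _

theorem neg_le_stefanMap_iterate (hn : 1 ≤ n) (h0 : 0 ≤ x) (hx : x ≤ n) (i : ℕ) :
    -(i : ℝ) ≤ (stefanMap n)^[2 * i] x := by
  induction i with
  | zero => simpa using h0
  | succ i ih =>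
    have hmem := stefanMap_iterate_mem_Icc (n := n) (x := x) ⟨by linarith, hx⟩
    rw [mul_add_one, iterate_succ_apply', iterate_succ_apply']
    set y := (stefanMap n)^[2 * i] x
    have h1 := stefanMap_le_one_sub (hmem (2 * i)).2
    have h2 := neg_max_le_stefanMap hn (neg_le_stefanMap n y) (stefanMap_le n y)
    have h3 : max (stefanMap n y) 0 ≤ i + 1 := max_le (by linarith) (by positivity)
    push_cast
    linarith

theorem le_of_minPeriod_stefanMap_odd (hn : 1 ≤ n) {k : ℕ} (hk : Odd k) (hk1 : k ≠ 1)
    (hx : MinPeriod (stefanMap n) x k) : 2 * n + 1 ≤ k := by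
  have hfix : stefanMap n (1 / 3) = 1 / 3 := by
    rw [stefanMap_of_mem_Icc hn] <;> norm_num
  have hne : ∀ i, (stefanMap n)^[i] x ≠ 1 / 3 := fun i hi =>
    hk1 ((hx.iterate i).eq_one_of_isFixedPt (by rw [hi, hfix]))
  obtain ⟨i, hi, hi'⟩ : ∃ i, (stefanMap n)^[i] x < 1 / 3 ∧ (stefanMap n)^[i + 1] x < 1 / 3 := by
    by_contra! hcon
    have hflip : ∀ i, (stefanMap n)^[i + 1] x < 1 / 3 ↔ ¬ (stefanMap n)^[i] x < 1 / 3 :=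
      fun i => by
        refine ⟨fun h h' => (hcon i h').not_gt h, fun h => ?_⟩
        rw [iterate_succ_apply']
        exact stefanMap_lt_third hn (lt_of_le_of_ne (not_lt.1 h) (hne i).symm)
    have hpar : ∀ i, (stefanMap n)^[2 * i] x < 1 / 3 ↔ x < 1 / 3 := fun i => by
      induction i with
      | zero => rfl
      | succ i ih => rw [mul_add_one, hflip, hflip, not_not, ih]
    obtain ⟨j, rfl⟩ := hk
    have h := hflip (2 * j)
    rw [hpar, hx.2.1] at h
    tauto
  set y := (stefanMap n)^[i] x
  have hy : MinPeriod (stefanMap n) y k := hx.iterate i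
  obtain ⟨w, hw⟩ := hy.mem_range
  have hmem : y ∈ Set.Icc (-n : ℝ) n := hw ▸ stefanMap_mem_Icc n w
  rw [iterate_succ_apply'] at hi'
  obtain ⟨h1, h2⟩ := le_of_stefanMap_lt_third hn hmem.1 hi hi'
  obtain ⟨j, rfl⟩ := hk
  have h3 := neg_le_stefanMap_iterate hn h2 (stefanMap_le n y) j
  rw [← iterate_succ_apply, Nat.succ_eq_add_one, hy.2.1] at h3
  have h4 : (n : ℝ) < j + 1 := by linarith
  have h5 : n < j + 1 := by exact_mod_cast h4
  omega

theorem stefanMap_iterate_of_nonpos (hn : 1 ≤ n) (hx : x ≤ 0) {l : ℕ} (hl : -n ≤ x - l) :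
    (stefanMap n)^[2 * l] x = x - l := by
  induction l with
  | zero => simp
  | succ l ih =>
    push_cast at hl
    have hl0 : (0 : ℝ) ≤ l := l.cast_nonneg
    rw [mul_add_one, iterate_succ_apply', iterate_succ_apply', ih (by linarith),
      stefanMap_of_nonpos (x := x - l) hn (by linarith) (by linarith),
      stefanMap_of_one_le (by linarith) (by linarith)]
    push_cast
    ring

theorem lt_stefanMap_iterate_of_nonpos (hn : 1 ≤ n) (hx : x ≤ 0) {l : ℕ} (hl : -n ≤ x - l)
    {i : ℕ} (hi : i < 2 * l) : x - l < (stefanMap n)^[i] x := by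
  obtain ⟨r, rfl | rfl⟩ := Nat.even_or_odd' i
  · have hr : (r : ℝ) < l := by exact_mod_cast (by omega : r < l)
    rw [stefanMap_iterate_of_nonpos hn hx (by linarith)]
    linarith
  · have hr : (r : ℝ) + 1 ≤ l := by exact_mod_cast (by omega : r + 1 ≤ l)
    have hr0 : (0 : ℝ) ≤ r := r.cast_nonneg
    rw [iterate_succ_apply', stefanMap_iterate_of_nonpos hn hx (by linarith),
      stefanMap_of_nonpos hn (by linarith) (by linarith)]
    linarith

/-- A point that reaches some `z ≤ 0` and from there returns along the outward spiral. -/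
theorem minPeriod_stefanMap_of_iterate (hn : 1 ≤ n) {z : ℝ} (hz : z ≤ 0) {j l : ℕ} (hj : 0 < j)
    (hx : -n ≤ x) (hxz : x = z - l) (hreach : (stefanMap n)^[j] x = z)
    (hlt : ∀ i, 0 < i → i < j → x < (stefanMap n)^[i] x) :
    MinPeriod (stefanMap n) x (2 * l + j) := by
  refine minPeriod_of_forall_lt (by omega) ?_ fun i hi hik => ?_
  · rw [iterate_add_apply, hreach, stefanMap_iterate_of_nonpos hn hz (by linarith), hxz]
  · rcases lt_or_ge i j with h | h
    · exact hlt i hi h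
    · obtain ⟨r, rfl⟩ := Nat.exists_eq_add_of_le' h
      rw [iterate_add_apply, hreach]
      have := lt_stefanMap_iterate_of_nonpos hn hz (l := l) (i := r) (by linarith) (by omega)
      linarith

theorem stefanMap_iterate_eq (hn : 1 ≤ n) {d : ℝ} {J : ℕ}
    (h : ∀ i ≤ J, (-2) ^ i * d ∈ Set.Icc (-(1 / 3) : ℝ) (2 / 3)) {i : ℕ} (hi : i ≤ J + 1) :
    (stefanMap n)^[i] (1 / 3 + d) = 1 / 3 + (-2) ^ i * d := by
  induction i with
  | zero => simp
  | succ i ih =>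
    obtain ⟨h1, h2⟩ := h i (by omega)
    rw [iterate_succ_apply', ih (by omega), stefanMap_of_mem_Icc hn (by linarith) (by linarith)]
    ring

theorem neg_two_pow_mul_mem_Icc {d : ℝ} {J : ℕ} (h0 : 0 ≤ (-2) ^ J * d)
    (h1 : (-2) ^ J * d ≤ 2 / 3) {i : ℕ} (hi : i ≤ J) :
    (-2) ^ i * d ∈ Set.Icc (-(1 / 3) : ℝ) (2 / 3) := by
  rcases hi.eq_or_lt with rfl | hlt
  · exact ⟨by linarith, h1⟩
  · have hpow : (2 : ℝ) ^ (i + 1) ≤ 2 ^ J := pow_le_pow_right₀ one_le_two hlt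
    have habs : ∀ r : ℕ, |(-2) ^ r * d| = 2 ^ r * |d| := fun r => by simp [abs_mul, abs_pow]
    have hJ : 2 ^ J * |d| ≤ 2 / 3 := by rwa [← habs, abs_of_nonneg h0]
    have hle : |(-2) ^ i * d| ≤ 1 / 3 := by
      rw [habs]
      rw [pow_succ] at hpow
      nlinarith [abs_nonneg d]
    obtain ⟨h2, h3⟩ := abs_le.1 hle
    exact ⟨h2, by linarith⟩

theorem one_le_or_le_neg_two_pow (J : ℕ) : (1 : ℝ) ≤ (-2) ^ J ∨ (-2 : ℝ) ^ J ≤ -2 := by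
  obtain ⟨r, rfl | rfl⟩ := Nat.even_or_odd' J
  · left
    rw [pow_mul]
    exact one_le_pow₀ (by norm_num)
  · right
    rw [pow_succ, pow_mul]
    have : (1 : ℝ) ≤ ((-2) ^ 2) ^ r := one_le_pow₀ (by norm_num)
    linarith

theorem exists_minPeriod_stefanMap_add (hn : 1 ≤ n) (J : ℕ) :
    ∃ x, MinPeriod (stefanMap n) x (2 * n + J) := by
  have hn' : (1 : ℝ) ≤ n := by exact_mod_cast hn
  obtain ⟨u, d, hu0, hu1, hy, hz, hd0, hd1⟩ : ∃ u d : ℝ, 0 ≤ u ∧ u < 1 ∧ n * u = 1 / 3 + d ∧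
      1 / 3 + (-2) ^ (J + 1) * d = u - 1 ∧ 0 ≤ (-2) ^ J * d ∧ (-2) ^ J * d ≤ 2 / 3 := by
    have hc := one_le_or_le_neg_two_pow J
    rw [pow_succ]
    generalize (-2 : ℝ) ^ J = c at hc ⊢
    have hE : 2 * c * n + 1 ≠ 0 := by
      rcases hc with hc | hc
      · nlinarith
      · intro h; nlinarith
    obtain ⟨E, hEc⟩ : ∃ E, E = 2 * c * n + 1 := ⟨_, rfl⟩
    rw [← hEc] at hE
    refine ⟨(2 * c + 4) / (3 * E), (4 * n - 1) / (3 * E), ?_, ?_,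
      by field_simp; rw [hEc]; ring, by field_simp; rw [hEc]; ring, ?_, ?_⟩
    all_goals rcases hc with hc | hc
    · exact div_nonneg (by linarith) (by nlinarith)
    · exact div_nonneg_of_nonpos (by linarith) (by nlinarith)
    · rw [div_lt_one (by nlinarith)]; nlinarith
    · rw [div_lt_one_of_neg (by nlinarith)]; nlinarith
    · exact mul_nonneg (by linarith) (div_nonneg (by linarith) (by nlinarith))
    · exact mul_nonneg_of_nonpos_of_nonpos (by linarith)
        (div_nonpos_of_nonneg_of_nonpos (by linarith) (by nlinarith))
    · rw [← mul_div_assoc, div_le_iff₀ (by nlinarith)]; nlinarith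
    · rw [← mul_div_assoc, div_le_iff_of_neg (by nlinarith)]; nlinarith
  have hmem := fun i (hi : i ≤ J) => neg_two_pow_mul_mem_Icc hd0 hd1 hi
  have hstep : ∀ i ≤ J + 1, (stefanMap n)^[i + 1] (u - n) = 1 / 3 + (-2) ^ i * d := by
    intro i hi
    rw [iterate_succ_apply, stefanMap_of_le_one_sub hn (by linarith) (by linarith),
      sub_add_cancel, hy, stefanMap_iterate_eq hn hmem hi]
  refine ⟨u - n, ?_⟩
  have hper : 2 * n + J = 2 * (n - 1) + (J + 2) := by omega
  rw [hper]
  refine minPeriod_stefanMap_of_iterate hn (z := u - 1) (by linarith) (by omega) (by linarith)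
    (by push_cast [hn]; ring) ((hstep (J + 1) le_rfl).trans hz) fun i hi hij => ?_
  obtain ⟨r, rfl⟩ := Nat.exists_eq_add_of_le' hi
  rw [hstep r (by omega)]
  linarith [(hmem r (by omega)).1]

theorem exists_minPeriod_stefanMap_even {l : ℕ} (hl : l + 1 < n) :
    ∃ x, MinPeriod (stefanMap n) x (2 * l + 2) := by
  have hn : 1 ≤ n := by omega
  have hn' : (1 : ℝ) ≤ n := by exact_mod_cast hn
  have hl' : (l : ℝ) + 2 ≤ n := by exact_mod_cast hl
  have hl0 : (0 : ℝ) ≤ l := l.cast_nonneg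
  obtain ⟨u, hu⟩ : ∃ u : ℝ, u * (n + 1) = n - l := ⟨(n - l) / (n + 1), by field_simp⟩
  have hu0 : 0 ≤ u := by nlinarith
  have hu1 : u ≤ 1 := by nlinarith
  have hnu : 1 ≤ n * u := by nlinarith
  have h1 : stefanMap n (u - n) = n * u := by
    rw [stefanMap_of_le_one_sub hn (by linarith) (by linarith), sub_add_cancel]
  refine ⟨u - n, minPeriod_stefanMap_of_iterate hn (z := -(n * u)) (by linarith) two_pos
    (by linarith) (by linarith) ?_ fun i hi hi2 => ?_⟩
  · rw [iterate_succ_apply, h1, iterate_one, stefanMap_of_one_le hnu (by nlinarith)]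
  · obtain rfl : i = 1 := by omega
    rw [iterate_one, h1]
    linarith

theorem periodSet_stefanMap (hn : 1 ≤ n) :
    periodSet (stefanMap n) = {k | k = 1 ∨ (0 < k ∧ (Odd k → 2 * n + 1 ≤ k))} := by
  ext k
  constructor
  · rintro ⟨x, hx⟩
    by_cases hk : k = 1
    · exact Or.inl hk
    · exact Or.inr ⟨hx.1, fun hodd => le_of_minPeriod_stefanMap_odd hn hodd hk hx⟩
  · rintro (rfl | ⟨hk, hodd⟩)
    · exact ⟨1 / 3, minPeriod_one (by rw [stefanMap_of_mem_Icc hn] <;> norm_num)⟩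
    · rcases le_or_gt (2 * n) k with h | h
      · obtain ⟨J, rfl⟩ := Nat.exists_eq_add_of_le h
        exact exists_minPeriod_stefanMap_add hn J
      · obtain ⟨l, rfl | rfl⟩ := Nat.even_or_odd' k
        · obtain ⟨l, rfl⟩ := Nat.exists_eq_add_of_le' (by omega : 1 ≤ l)
          exact exists_minPeriod_stefanMap_even (by omega)
        · have := hodd (odd_two_mul_add_one l)
          omega

theorem realizable_odd (hn : 1 ≤ n) :
    Realizable {k | k = 1 ∨ (0 < k ∧ (Odd k → 2 * n + 1 ≤ k))} := by
  rw [← periodSet_stefanMap hn]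
  have hn' : (1 : ℝ) ≤ n := by exact_mod_cast hn
  exact realizable_periodSet (by linarith) continuous_stefanMap (stefanMap_mem_Icc n)

end Stefan

/-! ### The Sharkovsky ordering -/

theorem exists_eq_two_pow_mul_odd_of_pos {k : ℕ} (hk : 0 < k) :
    ∃ c k' : ℕ, Odd k' ∧ k = 2 ^ c * k' := by
  obtain ⟨c, k', h, hk'⟩ := Nat.exists_eq_two_pow_mul_odd hk.ne'
  exact ⟨c, k', h, hk'⟩

theorem eq_of_odd_eq_two_pow_mul {k c k' : ℕ} (hk : Odd k) (h : k = 2 ^ c * k') :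
    c = 0 ∧ k = k' := by
  cases c with
  | zero => exact ⟨rfl, by simpa using h⟩
  | succ c =>
    rw [pow_succ', mul_assoc] at h
    exact absurd hk (by rw [h]; simp)

theorem not_sharkGt_one {k : ℕ} : ¬ SharkGt 1 k := by
  rintro ⟨a, m', c, k', -, -, h, -, h'⟩
  obtain ⟨rfl, rfl⟩ := eq_of_odd_eq_two_pow_mul odd_one h
  omega

theorem sharkGt_two_mul_iff {m k : ℕ} (hm : 0 < m) :
    SharkGt (2 * m) k ↔ k = 1 ∨ ∃ j, SharkGt m j ∧ k = 2 * j := by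
  constructor
  · rintro ⟨a, m', c, k', hm', hk', hma, rfl, h⟩
    cases a with
    | zero =>
      rw [pow_zero, one_mul] at hma
      exact absurd hm' (by rw [← hma]; simp)
    | succ a =>
      cases c with
      | zero => left; simp only [pow_zero, one_mul]; omega
      | succ c =>
        refine Or.inr ⟨2 ^ c * k', ⟨a, m', c, k', hm', hk', ?_, rfl, ?_⟩, by ring⟩
        · rw [pow_succ', mul_assoc] at hma
          omega
        · omega
  · rintro (rfl | ⟨j, ⟨a, m', c, k', hm', hk', rfl, rfl, h⟩, rfl⟩)
    · obtain ⟨a, m', hm', rfl⟩ := exists_eq_two_pow_mul_odd_of_pos hm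
      have := hm'.pos
      exact ⟨a + 1, m', 0, 1, hm', odd_one, by ring, rfl, by omega⟩
    · exact ⟨a + 1, m', c + 1, k', hm', hk', by ring, by ring, by omega⟩

theorem sharkGt_odd_iff {m k : ℕ} (hm : Odd m) (hm1 : 1 < m) :
    SharkGt m k ↔ k = 1 ∨ (0 < k ∧ (Odd k → m < k)) := by
  constructor
  · rintro ⟨a, m', c, k', -, hk', hma, hk, h⟩
    obtain ⟨rfl, rfl⟩ := eq_of_odd_eq_two_pow_mul hm hma
    have hpos : 0 < k := by have := hk'.pos; rw [hk]; positivity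
    by_cases hk1 : k = 1
    · exact Or.inl hk1
    · refine Or.inr ⟨hpos, fun hodd => ?_⟩
      obtain ⟨rfl, rfl⟩ := eq_of_odd_eq_two_pow_mul hodd hk
      omega
  · intro h
    have hpos : 0 < k := by omega
    obtain ⟨c, k', hk', rfl⟩ := exists_eq_two_pow_mul_odd_of_pos hpos
    have := hk'.pos
    refine ⟨0, m, c, k', hm, hk', by simp, rfl, ?_⟩
    cases c with
    | zero =>
      simp only [pow_zero, one_mul] at h
      rcases h with h | ⟨-, h⟩
      · omega
      · have := h hk'
        omega
    | succ c => omega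

theorem realizable_sharkovsky {m : ℕ} (hm : 0 < m) :
    Realizable ({m} ∪ {k | SharkGt m k}) := by
  induction m using Nat.strong_induction_on with
  | _ m ih =>
    obtain ⟨n, rfl | rfl⟩ := Nat.even_or_odd' m
    · convert (ih n (by omega) (by omega)).doubling using 1
      ext k
      simp only [Set.mem_union, Set.mem_singleton_iff, Set.mem_ofPred_eq,
        sharkGt_two_mul_iff (by omega : 0 < n), or_and_right, exists_or, exists_eq_left]
      tauto
    · rcases Nat.eq_zero_or_pos n with rfl | hn
      · convert realizable_singleton_one using 1
        ext k
        simp [not_sharkGt_one]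
      · convert realizable_odd hn using 1
        ext k
        simp only [Set.mem_union, Set.mem_singleton_iff, Set.mem_ofPred_eq,
          sharkGt_odd_iff (odd_two_mul_add_one n) (by omega)]
        constructor
        · rintro (rfl | rfl | ⟨h0, h⟩)
          · exact Or.inr ⟨by omega, fun _ => le_rfl⟩
          · exact Or.inl rfl
          · exact Or.inr ⟨h0, fun hk => (h hk).le⟩
        · rintro (rfl | ⟨h0, h⟩)
          · exact Or.inr (Or.inl rfl)
          · by_cases hk : k = 2 * n + 1
            · exact Or.inl hk
            · exact Or.inr (Or.inr ⟨h0, fun h' => lt_of_le_of_ne (h h') (Ne.symm hk)⟩)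

/-- Kloeden: for every positive integer `m` there is a continuous triangular map on
`I × I` whose set of minimal periods of periodic points is exactly
`S(m) = {m} ∪ {k : m >_s k}`, i.e. a triangular map of type `m`. -/
theorem triMap_realizes_sharkovsky_type (m : ℕ) (hm : 0 < m) :
    ∃ (f : I → I) (g : I × I → I), Continuous f ∧ Continuous g ∧
      {n : ℕ | ∃ z : I × I, MinPeriod (triMap f g) z n} = {m} ∪ {k : ℕ | SharkGt m k} := by
  exact (realizable_sharkovsky hm).exists_triMap
end

section
/- (Bowen's entropy bounds for triangular maps.) Let T(x,y) = (f(x), g(x,y)) be a continuous triangular map on I × I. Then max{ h(f), h_fib(T) } ≤ h(T) ≤ h(f) + h_fib(T), where h denotes topological entropy and h_fib(T) = sup_{x ∈ I} h(T, {x} × I). -/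
open Function Dynamics

/-- The unit interval `[0,1]`. -/
local notation "I" => unitInterval

open Set Filter Topology Uniformity UniformSpace ExpGrowth
open scoped SetRel

section Factor

variable {X Y : Type*} {T : X → X} {S : Y → Y} {π : X → Y}

/-- If every fiber over a `V`-ball admits a dynamical cover of cardinality at most `C ^ m` for some
time `m ≤ M`, then concatenating these covers along an orbit yields, for every time `n`, at most
`C ^ (n + M)` dynamically small sets covering the fiber over a dynamical `V`-ball. -/
lemma exists_small_sets_cover_preimage_dynBall (h : Semiconj π T S) {U : SetRel X X} [U.IsSymm]
    {V : SetRel Y Y} {C : ENNReal} (hC : 1 ≤ C) {M : ℕ}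
    (H : ∀ y, ∃ m, 0 < m ∧ m ≤ M ∧ ∃ s : Finset X,
      IsDynCoverOf T (π ⁻¹' ball y V) U m s ∧ (s.card : ENNReal) ≤ C ^ m) (n : ℕ) (y : Y) :
    ∃ A : Finset (Set X), (A.card : ENNReal) ≤ C ^ (n + M) ∧
      (∀ x, π x ∈ ball y (dynEntourage S V n) → ∃ a ∈ A, x ∈ a) ∧
      ∀ a ∈ A, ∀ x ∈ a, ∀ x' ∈ a, (x, x') ∈ dynEntourage T (U ○ U) n := by
  classical
  induction n using Nat.strong_induction_on generalizing y with
  | _ n ih =>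
  rcases n.eq_zero_or_pos with rfl | hn
  · exact ⟨{univ}, by simpa using one_le_pow₀ hC, by simp, by simp⟩
  obtain ⟨m, m_pos, m_M, s, s_cover, s_card⟩ := H y
  have s_cover' : ∀ x, π x ∈ ball y (dynEntourage S V n) →
      ∃ z ∈ s, (x, z) ∈ dynEntourage T U m := fun x hx ↦
    s_cover (mem_ball_dynEntourage.1 hx 0 hn)
  have small : ∀ z x x', (x, z) ∈ dynEntourage T U m → (x', z) ∈ dynEntourage T U m →
      (x, x') ∈ dynEntourage T (U ○ U) m := fun z x x' hx hx' ↦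
    dynEntourage_comp_subset T U U m (SetRel.prodMk_mem_comp hx (SetRel.symm _ hx'))
  rcases le_or_gt n m with n_m | m_n
  · refine ⟨s.image fun z ↦ {x | (x, z) ∈ dynEntourage T U m}, ?_, fun x hx ↦ ?_, ?_⟩
    · calc ((s.image fun z ↦ {x | (x, z) ∈ dynEntourage T U m}).card : ENNReal)
          ≤ s.card := by exact_mod_cast Finset.card_image_le
        _ ≤ C ^ m := s_card
        _ ≤ C ^ (n + M) := pow_le_pow_right₀ hC (by omega)
    · obtain ⟨z, hz, hxz⟩ := s_cover' x hx
      exact ⟨_, Finset.mem_image_of_mem _ hz, hxz⟩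
    · intro a ha x hx x' hx'
      obtain ⟨z, -, rfl⟩ := Finset.mem_image.1 ha
      exact dynEntourage_antitone T _ n_m (small z x x' hx hx')
  · obtain ⟨A, A_card, A_cover, A_small⟩ := ih (n - m) (by omega) (S^[m] y)
    refine ⟨Finset.image₂ (fun z a ↦ {x | (x, z) ∈ dynEntourage T U m} ∩ T^[m] ⁻¹' a) s A,
      ?_, fun x hx ↦ ?_, ?_⟩
    · calc _ ≤ ((s.card * A.card : ℕ) : ENNReal) := Nat.cast_le.2 (Finset.card_image₂_le _ _ _)
        _ ≤ C ^ m * C ^ (n - m + M) := by push_cast; gcongr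
        _ = C ^ (n + M) := by rw [← pow_add]; congr 1; omega
    · obtain ⟨z, hz, hxz⟩ := s_cover' x hx
      obtain ⟨a, ha, hxa⟩ := A_cover (T^[m] x) <| by
        rw [mem_ball_dynEntourage] at hx ⊢
        intro k hk
        have := hx (k + m) (by omega)
        rwa [iterate_add_apply, iterate_add_apply, ← (h.iterate_right m).eq] at this
      exact ⟨_, Finset.mem_image₂_of_mem hz ha, hxz, hxa⟩
    · intro b hb x hx x' hx'
      obtain ⟨z, -, a, ha, rfl⟩ := Finset.mem_image₂.1 hb
      have h₁ := mem_dynEntourage.1 (small z x x' hx.1 hx'.1)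
      have h₂ := mem_dynEntourage.1 (A_small a ha _ hx.2 _ hx'.2)
      refine mem_dynEntourage.2 fun k hk ↦ ?_
      rcases lt_or_ge k m with k_m | m_k
      · exact h₁ k k_m
      · have := h₂ (k - m) (by omega)
        rwa [← iterate_add_apply, ← iterate_add_apply, Nat.sub_add_cancel m_k] at this

lemma coverMincard_le_mul_pow_of_fiber_covers [Nonempty X] (h : Semiconj π T S)
    {U : SetRel X X} [U.IsSymm] {V : SetRel Y Y} [V.IsSymm] {C : ENNReal} (hC : 1 ≤ C) {M : ℕ}
    (H : ∀ y, ∃ m, 0 < m ∧ m ≤ M ∧ ∃ s : Finset X,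
      IsDynCoverOf T (π ⁻¹' ball y V) U m s ∧ (s.card : ENNReal) ≤ C ^ m) {n : ℕ}
    (hn : coverMincard S univ V n < ⊤) :
    (coverMincard T univ (U ○ U) n : ENNReal) ≤ coverMincard S univ V n * C ^ (n + M) := by
  classical
  obtain ⟨E, E_cover, E_card⟩ := (coverMincard_finite_iff S univ V n).1 hn
  choose A A_card A_cover A_small using exists_small_sets_cover_preimage_dynBall h hC H n
  let pick : Set X → X := fun a ↦ Classical.epsilon (· ∈ a)
  have cover : IsDynCoverOf T univ (U ○ U) n (E.biUnion fun e ↦ (A e).image pick : Finset X) := by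
    intro x _
    obtain ⟨e, he, hxe⟩ := E_cover (mem_univ (π x))
    obtain ⟨a, ha, hxa⟩ := A_cover e x (SetRel.symm (dynEntourage S V n) hxe)
    refine ⟨pick a, ?_, A_small e a ha x hxa _ (Classical.epsilon_spec ⟨x, hxa⟩)⟩
    exact Finset.mem_coe.2 (Finset.mem_biUnion.2 ⟨e, he, Finset.mem_image_of_mem _ ha⟩)
  calc (coverMincard T univ (U ○ U) n : ENNReal)
      ≤ ((E.biUnion fun e ↦ (A e).image pick).card : ENNReal) := by
        exact_mod_cast ENat.toENNReal_mono cover.coverMincard_le_card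
    _ ≤ ∑ e ∈ E, ((A e).card : ENNReal) := by
        exact_mod_cast Finset.card_biUnion_le.trans
          (Finset.sum_le_sum fun e _ ↦ Finset.card_image_le)
    _ ≤ ∑ _e ∈ E, C ^ (n + M) := Finset.sum_le_sum fun e _ ↦ A_card e
    _ = coverMincard S univ V n * C ^ (n + M) := by
        rw [Finset.sum_const, nsmul_eq_mul, ← E_card, ENat.toENNReal_coe]

variable [UniformSpace X] [CompactSpace X] [UniformSpace Y] [CompactSpace Y] [T2Space Y]

/-- Fiberwise entropy bounds give covers of the fibers over uniformly small balls, of uniformly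
bounded length. -/
lemma exists_uniform_fiber_covers (hT : Continuous T) (hπ : Continuous π) {b : EReal}
    (hb : ∀ y, coverEntropy T (π ⁻¹' {y}) < b) {U : SetRel X X} (hU : U ∈ 𝓤 X)
    (hU_open : IsOpen U) :
    ∃ V ∈ 𝓤 Y, SetRel.IsSymm V ∧ ∃ M : ℕ, ∀ y, ∃ m, 0 < m ∧ m ≤ M ∧ ∃ s : Finset X,
      IsDynCoverOf T (π ⁻¹' ball y V) U m s ∧ (s.card : ENNReal) ≤ EReal.exp b ^ m := by
  have fiber : ∀ y, ∃ m, 0 < m ∧ ∃ s : Finset X,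
      IsDynCoverOf T (π ⁻¹' {y}) U m s ∧ (s.card : ENNReal) ≤ EReal.exp b ^ m := by
    intro y
    have key := eventually_le_exp
      ((coverEntropyEntourage_le_coverEntropy T (π ⁻¹' {y}) hU).trans_lt (hb y))
    obtain ⟨m, hm, m_pos⟩ := (key.and (eventually_gt_atTop 0)).exists
    obtain ⟨s, s_cover, s_card⟩ := (coverMincard_finite_iff T _ U m).1 <|
      coverMincard_finite_of_isCompact_uniformContinuous
        (isClosed_singleton.preimage hπ).isCompact
        (CompactSpace.uniformContinuous_of_continuous hT) hU m
    refine ⟨m, m_pos, s, s_cover, ?_⟩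
    rwa [← s_card, ENat.toENNReal_coe, mul_comm, EReal.exp_nmul] at hm
  choose m m_pos s s_cover s_card using fiber
  let O : Y → Set X := fun y ↦ ⋃ z ∈ s y, {x | (x, z) ∈ dynEntourage T U (m y)}
  have O_open : ∀ y, IsOpen (O y) := fun y ↦ isOpen_biUnion fun z _ ↦
    (isOpen.dynEntourage hT hU_open (m y)).preimage (Continuous.prodMk_left z)
  let W : Y → Set Y := fun y ↦ (π '' (O y)ᶜ)ᶜ
  have W_open : ∀ y, IsOpen (W y) := fun y ↦
    (hπ.isClosedMap _ (O_open y).isClosed_compl).isOpen_compl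
  have W_mem : ∀ y, y ∈ W y := by
    rintro y ⟨x, hx, rfl⟩
    obtain ⟨z, hz, hxz⟩ := s_cover (π x) (show x ∈ π ⁻¹' {π x} from rfl)
    exact hx (mem_biUnion (Finset.mem_coe.1 hz) hxz)
  obtain ⟨t, ht⟩ := isCompact_univ.elim_finite_subcover W W_open
    fun y _ ↦ mem_iUnion.2 ⟨y, W_mem y⟩
  obtain ⟨V', hV', V'_sub⟩ := lebesgue_number_lemma (U := fun i : t ↦ W i) isCompact_univ
    (fun i ↦ W_open i) (by rwa [iUnion_subtype])
  obtain ⟨V, hV, V_symm, V_V'⟩ := symm_of_uniformity hV'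
  refine ⟨V, hV, V_symm, t.sup m, fun y ↦ ?_⟩
  obtain ⟨i, hi⟩ := V'_sub y (mem_univ y)
  refine ⟨m i, m_pos i, Finset.le_sup i.2, s i, fun x hx ↦ ?_, s_card i⟩
  have hxO : x ∈ O i := by
    by_contra hxO
    exact hi (V_V' hx) ⟨x, hxO, rfl⟩
  simpa [O] using hxO

/-- **Bowen's inequality** for a factor map `π` between compact systems. -/
theorem coverEntropy_le_add_iSup_fiber [Nonempty X] (h : Semiconj π T S) (hT : Continuous T)
    (hS : Continuous S) (hπ : Continuous π) :
    coverEntropy T univ ≤ coverEntropy S univ + ⨆ y, coverEntropy T (π ⁻¹' {y}) := by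
  obtain ⟨x⟩ := ‹Nonempty X›
  have hS_nonneg : 0 ≤ coverEntropy S univ := coverEntropy_nonneg S ⟨π x, mem_univ _⟩
  have fib_nonneg : 0 ≤ ⨆ y, coverEntropy T (π ⁻¹' {y}) :=
    le_iSup_of_le (π x) (coverEntropy_nonneg T ⟨x, rfl⟩)
  have ne_bot {a : EReal} (ha : 0 ≤ a) : a ≠ ⊥ := (EReal.bot_lt_zero.trans_le ha).ne'
  refine EReal.le_add_of_forall_gt (.inl (ne_bot hS_nonneg)) (.inr (ne_bot fib_nonneg))
    fun a ha b hb ↦ ?_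
  have b_pos : 0 < b := fib_nonneg.trans_lt hb
  rcases eq_or_ne b ⊤ with rfl | b_top
  · rw [EReal.add_top_of_ne_bot (ne_bot (hS_nonneg.trans ha.le))]
    exact le_top
  refine (add_le_add_left ha.le b).trans' (iSup₂_le fun U₀ hU₀ ↦ ?_)
  obtain ⟨U, hU, U_open, U_symm, U_U₀⟩ := comp_open_symm_mem_uniformity_sets hU₀
  obtain ⟨V, hV, V_symm, M, H⟩ := exists_uniform_fiber_covers hT hπ
    (fun y ↦ (le_iSup (fun y ↦ coverEntropy T (π ⁻¹' {y})) y).trans_lt hb) hU U_open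
  have hC : 1 ≤ EReal.exp b := by simpa using b_pos.le
  have hC_top : EReal.exp b ≠ ⊤ := by simpa using b_top
  calc coverEntropyEntourage T univ U₀
      ≤ coverEntropyEntourage T univ (U ○ U) := coverEntropyEntourage_antitone T univ U_U₀
    _ ≤ expGrowthSup ((fun n ↦ (coverMincard S univ V n : ENNReal)) *
          fun n ↦ EReal.exp b ^ n) := by
        refine expGrowthSup_le_of_eventually_le (ENNReal.pow_ne_top hC_top)
          (Eventually.of_forall fun n ↦ ?_) (b := EReal.exp b ^ M)
        have := coverMincard_le_mul_pow_of_fiber_covers h hC H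
          (coverMincard_finite_of_isCompact_uniformContinuous isCompact_univ
            (CompactSpace.uniformContinuous_of_continuous hS) hV n)
        rw [pow_add] at this
        refine this.trans_eq ?_
        simp only [Pi.mul_apply]
        ring
    _ ≤ coverEntropyEntourage S univ V + b := by
        refine (expGrowthSup_mul_le (.inr ?_) (.inr ?_)).trans_eq ?_ <;>
          rw [expGrowthSup_pow, EReal.log_exp]
        exacts [b_top, ne_bot b_pos.le, rfl]
    _ ≤ coverEntropy S univ + b := by
        gcongr
        exact coverEntropyEntourage_le_coverEntropy S univ hV

end Factor

/-- Bowen's entropy bounds for triangular maps: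
`max (h f) (h_fib T) ≤ h T ≤ h f + h_fib T`, where
`h_fib T = ⨆ x, h (T, {x} × I)`. -/
theorem triMap_entropy_bounds (f : I → I) (g : I × I → I)
    (hf : Continuous f) (hg : Continuous g) :
    max (coverEntropy f Set.univ)
        (⨆ x : I, coverEntropy (triMap f g) ({x} ×ˢ (Set.univ : Set I))) ≤
      coverEntropy (triMap f g) Set.univ ∧
    coverEntropy (triMap f g) Set.univ ≤
      coverEntropy f Set.univ +
        ⨆ x : I, coverEntropy (triMap f g) ({x} ×ˢ (Set.univ : Set I)) := by
  have h : Semiconj Prod.fst (triMap f g) f := fun _ ↦ rfl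
  have hT : Continuous (triMap f g) := (hf.comp continuous_fst).prodMk hg
  refine ⟨max_le ?_ (iSup_le fun x ↦ coverEntropy_monotone _ (subset_univ _)), ?_⟩
  · simpa [image_univ, Prod.range_fst] using coverEntropy_image_le_of_uniformContinuous h
      (CompactSpace.uniformContinuous_of_continuous continuous_fst) univ
  · simpa only [prod_univ] using coverEntropy_le_add_iSup_fiber h hT hf continuous_fst
end

section
/- Let T(x,y) = (f(x), g(x,y)) be a continuous triangular map on I × I such that for every fixed x ∈ I the fiber map y ↦ g(x,y) is monotone on I. Then h(T, {x} × I) = 0 for every x ∈ I and h(T) = h(f). -/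
open Function Dynamics

/-- The unit interval `[0,1]`. -/
local notation "I" => unitInterval

open Filter Topology Uniformity ExpGrowth

section Extension

variable {X Z : Type*} {T : Z → Z} {f : X → X} {π : Z → X} {U : SetRel Z Z} {V : SetRel X X}
  {m C : ℕ}

/-- If, over every `V`-ball of the base, the `m`-step dynamics of an extension is coded up to `U`
by `C` labels, then dynamical covers of the base lift to the extension, at the cost of a factor
`C` for every block of `m` steps. -/
lemma coverMincard_preimage_mul_le (h : Semiconj π T f) (F : Set X) (hC : C ≠ 0)
    (c : X → Z → Fin C)
    (hc : ∀ x z z', (π z, x) ∈ V → (π z', x) ∈ V → c x z = c x z' →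
      (z, z') ∈ dynEntourage T U m) (n : ℕ) :
    coverMincard T (π ⁻¹' F) U (m * n) ≤ coverMincard f F V (m * n) * (C : ℕ∞) ^ n := by
  classical
  rcases eq_top_or_lt_top (coverMincard f F V (m * n)) with htop | hfin
  · rw [htop, ENat.top_mul (pow_ne_zero _ (by exact_mod_cast hC))]
    exact le_top
  obtain ⟨s, hs, hcard⟩ := (coverMincard_finite_iff f F V (m * n)).1 hfin
  rcases isEmpty_or_nonempty Z with hZ | hZ
  · rw [Set.eq_empty_of_isEmpty (π ⁻¹' F), coverMincard_empty]
    exact zero_le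
  let A : X × (Fin n → Fin C) → Set Z := fun p =>
    {z | (π z, p.1) ∈ dynEntourage f V (m * n) ∧
      ∀ j : Fin n, c (f^[m * j] p.1) (T^[m * j] z) = p.2 j}
  have hrep : ∀ p, ∃ z, (A p).Nonempty → z ∈ A p := fun p => by
    by_cases hp : (A p).Nonempty
    · exact ⟨hp.some, fun _ => hp.some_mem⟩
    · exact ⟨hZ.some, fun h' => (hp h').elim⟩
  choose r hr using hrep
  have hclose : ∀ p, ∀ z ∈ A p, ∀ z' ∈ A p, (z, z') ∈ dynEntourage T U (m * n) := by
    rintro p z ⟨hz, hzl⟩ z' ⟨hz', hzl'⟩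
    rw [mem_dynEntourage] at hz hz' ⊢
    intro k hk
    have hm : 0 < m := Nat.pos_of_mul_pos_right (by omega : 0 < m * n)
    have hj : k / m < n := Nat.div_lt_of_lt_mul hk
    have hjm : m * (k / m) < m * n := Nat.mul_lt_mul_of_pos_left hj hm
    have key := hc (f^[m * (k / m)] p.1) (T^[m * (k / m)] z) (T^[m * (k / m)] z')
      (by rw [(h.iterate_right _).eq]; exact hz _ hjm)
      (by rw [(h.iterate_right _).eq]; exact hz' _ hjm)
      ((hzl ⟨_, hj⟩).trans (hzl' ⟨_, hj⟩).symm)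
    have := mem_dynEntourage.1 key (k % m) (Nat.mod_lt _ hm)
    rwa [← iterate_add_apply, ← iterate_add_apply, Nat.mod_add_div] at this
  have hcover : IsDynCoverOf T (π ⁻¹' F) U (m * n)
      ((s ×ˢ (Finset.univ : Finset (Fin n → Fin C))).image r : Finset Z) := by
    intro z hz
    obtain ⟨x, hxs, hx⟩ := hs hz
    have hzA : z ∈ A (x, fun j => c (f^[m * j] x) (T^[m * j] z)) := ⟨hx, fun _ => rfl⟩
    refine ⟨r (x, fun j => c (f^[m * j] x) (T^[m * j] z)), ?_,
      hclose _ z hzA _ (hr _ ⟨z, hzA⟩)⟩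
    rw [Finset.coe_image]
    exact Set.mem_image_of_mem _ (by simpa using hxs)
  refine hcover.coverMincard_le_card.trans ?_
  rw [← hcard]
  refine (Nat.cast_le.2 Finset.card_image_le).trans_eq ?_
  simp

lemma coverEntropyEntourage_preimage_le (h : Semiconj π T f) (F : Set X) (hm : m ≠ 0) (hC : C ≠ 0)
    (c : X → Z → Fin C)
    (hc : ∀ x z z', (π z, x) ∈ V → (π z', x) ∈ V → c x z = c x z' →
      (z, z') ∈ dynEntourage T U m) :
    coverEntropyEntourage T (π ⁻¹' F) U ≤
      coverEntropyEntourage f F V + ((Real.log C / m : ℝ) : EReal) := by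
  have hlog : ENNReal.log (C : ENNReal) = (Real.log C : ℝ) := by
    rw [← ENNReal.ofReal_natCast, ENNReal.log_ofReal_of_pos (by positivity)]
  have hT : Monotone fun n => ((coverMincard T (π ⁻¹' F) U n : ℕ∞) : ENNReal) :=
    fun _ _ hab => ENat.toENNReal_mono (coverMincard_monotone_time T (π ⁻¹' F) U hab)
  have hf : Monotone fun n => ((coverMincard f F V n : ℕ∞) : ENNReal) :=
    fun _ _ hab => ENat.toENNReal_mono (coverMincard_monotone_time f F V hab)
  have key : (m : EReal) * coverEntropyEntourage T (π ⁻¹' F) U ≤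
      m * coverEntropyEntourage f F V + (Real.log C : ℝ) := by
    rw [coverEntropyEntourage, coverEntropyEntourage,
      ← hT.expGrowthSup_comp_mul hm, ← hf.expGrowthSup_comp_mul hm,
      ← hlog, ← expGrowthSup_pow (b := (C : ENNReal))]
    refine (expGrowthSup_monotone fun n => ?_).trans (expGrowthSup_mul_le ?_ ?_)
    · have := ENat.toENNReal_mono (coverMincard_preimage_mul_le h F hC c hc n)
      simpa using this
    · right; rw [expGrowthSup_pow, hlog]; exact EReal.coe_ne_top _
    · right; rw [expGrowthSup_pow, hlog]; exact EReal.coe_ne_bot _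
  have hm0 : (0 : EReal) < m := by exact_mod_cast Nat.pos_of_ne_zero hm
  have hmt : (m : EReal) ≠ ⊤ := EReal.natCast_ne_top m
  rw [mul_comm, ← EReal.le_div_iff_mul_le hm0 hmt, EReal.add_div_of_nonneg_right hm0.le] at key
  refine key.trans_eq ?_
  rw [← EReal.mul_div, EReal.mul_div_cancel (EReal.natCast_ne_bot m) hmt hm0.ne', EReal.coe_div,
    EReal.coe_natCast]

end Extension

lemma tendsto_log_mul_add_one_div (N : ℕ) :
    Tendsto (fun m : ℕ => Real.log ((m * N + 1 : ℕ) : ℝ) / m) atTop (𝓝 0) := by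
  have h : (fun m : ℕ => Real.log ((m * (N + 1) : ℕ) : ℝ)) =o[atTop]
      fun m : ℕ => ((m * (N + 1) : ℕ) : ℝ) :=
    Real.isLittleO_log_id_atTop.comp_tendsto (tendsto_natCast_atTop_atTop.comp
      (tendsto_id.atTop_mul_const' (Nat.succ_pos N)))
  have h' := h.tendsto_div_nhds_zero.mul_const ((N : ℝ) + 1)
  rw [zero_mul] at h'
  refine squeeze_zero' (Eventually.of_forall fun m => by positivity) ?_ h'
  filter_upwards [eventually_ge_atTop 1] with m hm
  have hm' : (1 : ℝ) ≤ m := by exact_mod_cast hm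
  have : Real.log ((m * N + 1 : ℕ) : ℝ) ≤ Real.log ((m * (N + 1) : ℕ) : ℝ) := by
    apply Real.log_le_log (by positivity)
    push_cast
    linarith
  calc _ ≤ Real.log ((m * (N + 1) : ℕ) : ℝ) / m := by gcongr
    _ = _ := by
      push_cast
      field_simp

/-- Finitely many monotone self-maps of the interval are simultaneously constant up to `1 / N`
on the cells of a partition whose size is linear in the number of maps. -/
lemma exists_label_of_monotone (φ : ℕ → I → I) (hφ : ∀ k, Monotone (φ k) ∨ Antitone (φ k))
    (m N : ℕ) :
    ∃ c : I → Fin (m * N + 1), ∀ y y', c y = c y' →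
      ∀ k < m, N * dist (φ k y) (φ k y') < 1 := by
  have hψ : ∀ k, ∃ ψ : I → I, Monotone ψ ∧ ∀ y y', dist (φ k y) (φ k y') = dist (ψ y) (ψ y') := by
    intro k
    rcases hφ k with h | h
    · exact ⟨φ k, h, fun _ _ => rfl⟩
    · refine ⟨fun y => unitInterval.symm (φ k y),
        fun a b hab => unitInterval.symm_le_symm.2 (h hab), fun y y' => ?_⟩
      rw [Subtype.dist_eq, Subtype.dist_eq, unitInterval.coe_symm_eq, unitInterval.coe_symm_eq,
        dist_sub_left]
  choose ψ hmono hdist using hψ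
  let q : ℕ → I → ℕ := fun k y => ⌊(N : ℝ) * (ψ k y : ℝ)⌋₊
  have hq : ∀ k, Monotone (q k) := fun k a b hab =>
    Nat.floor_mono (mul_le_mul_of_nonneg_left (hmono k hab) N.cast_nonneg)
  have hqN : ∀ k y, q k y ≤ N := fun k y =>
    Nat.floor_le_of_le (mul_le_of_le_one_right N.cast_nonneg (ψ k y).2.2)
  have hsum : ∀ y, ∑ k ∈ Finset.range m, q k y < m * N + 1 := fun y => by
    have := Finset.sum_le_card_nsmul (Finset.range m) (fun k => q k y) N fun k _ => hqN k y
    simp only [Finset.card_range, smul_eq_mul] at this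
    omega
  refine ⟨fun y => ⟨∑ k ∈ Finset.range m, q k y, hsum y⟩, fun y y' hyy k hk => ?_⟩
  have hs : ∑ k ∈ Finset.range m, q k y = ∑ k ∈ Finset.range m, q k y' := congrArg Fin.val hyy
  have hqk : q k y = q k y' := by
    rcases le_total y y' with hle | hle
    · exact (Finset.sum_eq_sum_iff_of_le fun k _ => hq k hle).1 hs k (Finset.mem_range.2 hk)
    · exact ((Finset.sum_eq_sum_iff_of_le fun k _ => hq k hle).1 hs.symm k
        (Finset.mem_range.2 hk)).symm
  have hnn : ∀ z, 0 ≤ (N : ℝ) * (ψ k z : ℝ) := fun z => mul_nonneg N.cast_nonneg (ψ k z).2.1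
  have h1 := Nat.floor_le (hnn y)
  have h2 := Nat.lt_floor_add_one ((N : ℝ) * (ψ k y : ℝ))
  have h3 := Nat.floor_le (hnn y')
  have h4 := Nat.lt_floor_add_one ((N : ℝ) * (ψ k y' : ℝ))
  have hqk' : ((⌊(N : ℝ) * (ψ k y : ℝ)⌋₊ : ℕ) : ℝ) = (⌊(N : ℝ) * (ψ k y' : ℝ)⌋₊ : ℕ) :=
    congrArg Nat.cast hqk
  rw [hdist, Subtype.dist_eq, Real.dist_eq, ← Nat.abs_cast N, ← abs_mul, abs_lt]
  constructor <;> linarith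

lemma semiconj_fst_triMap (f : I → I) (g : I × I → I) : Semiconj Prod.fst (triMap f g) f :=
  fun _ => rfl

lemma triMap_iterate_fst (f : I → I) (g : I × I → I) (k : ℕ) (z : I × I) :
    ((triMap f g)^[k] z).1 = f^[k] z.1 :=
  ((semiconj_fst_triMap f g).iterate_right k).eq z

lemma monotone_or_antitone_triMap_iterate_snd {f : I → I} {g : I × I → I}
    (hmono : ∀ x : I, Monotone (fun y : I => g (x, y)) ∨ Antitone (fun y : I => g (x, y)))
    (x : I) (k : ℕ) :
    Monotone (fun y => ((triMap f g)^[k] (x, y)).2) ∨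
      Antitone (fun y => ((triMap f g)^[k] (x, y)).2) := by
  induction k with
  | zero => exact Or.inl monotone_id
  | succ k ih =>
    have hstep : (fun y => ((triMap f g)^[k + 1] (x, y)).2) =
        (fun y => g (f^[k] x, y)) ∘ fun y => ((triMap f g)^[k] (x, y)).2 := by
      funext y
      rw [iterate_succ_apply', comp_apply, ← triMap_iterate_fst f g k (x, y)]
      rfl
    rw [hstep]
    rcases hmono (f^[k] x) with h | h <;> rcases ih with h' | h'
    · exact Or.inl (h.comp h')
    · exact Or.inr (h.comp_antitone h')
    · exact Or.inr (h.comp_monotone h')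
    · exact Or.inl (h.comp h')

/-- Monotone fibers do not contribute to the entropy of a triangular map. -/
lemma coverEntropy_triMap_preimage_fst_le {f : I → I} {g : I × I → I}
    (hf : Continuous f) (hg : Continuous g)
    (hmono : ∀ x : I, Monotone (fun y : I => g (x, y)) ∨ Antitone (fun y : I => g (x, y)))
    (F : Set I) :
    coverEntropy (triMap f g) (Prod.fst ⁻¹' F) ≤ coverEntropy f F := by
  have hT : UniformContinuous (triMap f g) := CompactSpace.uniformContinuous_of_continuous
    ((hf.comp continuous_fst).prodMk hg)
  refine iSup₂_le fun U hU => ?_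
  obtain ⟨ε, hε, hεU⟩ := Metric.mem_uniformity_dist.1 hU
  obtain ⟨N, hN⟩ := exists_nat_gt (3 / ε)
  have hN' : 1 < N * (ε / 3) := by
    rw [div_lt_iff₀ hε] at hN
    linarith
  have hbound : ∀ m : ℕ, m ≠ 0 → coverEntropyEntourage (triMap f g) (Prod.fst ⁻¹' F) U ≤
      coverEntropy f F + ((Real.log ((m * N + 1 : ℕ) : ℝ) / m : ℝ) : EReal) := by
    intro m hm
    obtain ⟨δ, hδ, hδW⟩ := Metric.mem_uniformity_dist.1
      (dynEntourage_mem_uniformity hT (Metric.dist_mem_uniformity (by positivity : 0 < ε / 3)) m)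
    choose c hc using fun x : I => exists_label_of_monotone
      (fun k y => ((triMap f g)^[k] (x, y)).2)
      (monotone_or_antitone_triMap_iterate_snd hmono x) m N
    refine (coverEntropyEntourage_preimage_le (V := {p : I × I | dist p.1 p.2 < δ})
      (semiconj_fst_triMap f g) F hm (Nat.succ_ne_zero _) (fun x z => c x z.2) ?_).trans
      (add_le_add_left (coverEntropyEntourage_le_coverEntropy f F
        (Metric.dist_mem_uniformity hδ)) _)
    intro x z z' hz hz' hcz
    rw [mem_dynEntourage]
    intro k hk
    have hnear : ∀ w : I × I, dist w.1 x < δ →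
        dist ((triMap f g)^[k] w) ((triMap f g)^[k] (x, w.2)) < ε / 3 := fun w hw =>
      mem_dynEntourage.1 (hδW (a := w) (b := (x, w.2)) (by
        rw [Prod.dist_eq, dist_self]; exact max_lt hw hδ)) k hk
    have hfiber : dist ((triMap f g)^[k] (x, z.2)) ((triMap f g)^[k] (x, z'.2)) < ε / 3 := by
      rw [Prod.dist_eq, triMap_iterate_fst, triMap_iterate_fst, dist_self]
      refine max_lt (by positivity) ?_
      exact lt_of_mul_lt_mul_left ((hc x _ _ hcz k hk).trans hN') N.cast_nonneg
    apply hεU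
    have h1 := hnear z hz
    have h2 := hnear z' hz'
    rw [dist_comm] at h2
    linarith [dist_triangle4 ((triMap f g)^[k] z) ((triMap f g)^[k] (x, z.2))
      ((triMap f g)^[k] (x, z'.2)) ((triMap f g)^[k] z')]
  have hlim : Tendsto (fun m : ℕ => coverEntropy f F +
      ((Real.log ((m * N + 1 : ℕ) : ℝ) / m : ℝ) : EReal)) atTop (𝓝 (coverEntropy f F)) := by
    have h0 := (continuous_coe_real_ereal.tendsto 0).comp (tendsto_log_mul_add_one_div N)
    have hadd := (EReal.continuousAt_add (p := (coverEntropy f F, ((0 : ℝ) : EReal)))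
      (Or.inr (EReal.coe_ne_bot 0)) (Or.inr (EReal.coe_ne_top 0))).tendsto.comp
      (tendsto_const_nhds.prodMk_nhds h0)
    simpa [comp_def] using hadd
  exact ge_of_tendsto hlim (eventually_atTop.2 ⟨1, fun m hm => hbound m (by omega)⟩)

lemma coverEntropy_singleton_le_zero {X : Type*} [UniformSpace X] (T : X → X) (x : X) :
    coverEntropy T {x} ≤ 0 := by
  rw [coverEntropy_eq_iSup_basis UniformSpace.hasBasis_symmetric]
  refine iSup₂_le fun U hU => ?_
  rw [← expGrowthSup_const one_ne_zero ENNReal.one_ne_top]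
  refine expGrowthSup_monotone fun n => ?_
  have hcov : IsDynCoverOf T {x} U n (({x} : Finset X) : Set X) := by
    rintro _ rfl
    exact ⟨_, by simp, mem_dynEntourage.2 fun k _ => refl_mem_uniformity hU.1⟩
  have := ENat.toENNReal_mono hcov.coverMincard_le_card
  simpa using this

/-- If all the fiber maps `y ↦ g (x, y)` are monotone, then `h (T, {x} × I) = 0` for
every `x` and `h T = h f`. -/
theorem triMap_entropy_of_monotone_fibers (f : I → I) (g : I × I → I)
    (hf : Continuous f) (hg : Continuous g)
    (hmono : ∀ x : I, Monotone (fun y : I => g (x, y)) ∨ Antitone (fun y : I => g (x, y))) :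
    (∀ x : I, coverEntropy (triMap f g) ({x} ×ˢ (Set.univ : Set I)) = 0) ∧
    coverEntropy (triMap f g) Set.univ = coverEntropy f Set.univ := by
  refine ⟨fun x => le_antisymm ?_ (coverEntropy_nonneg _ ⟨(x, x), rfl, trivial⟩),
    le_antisymm ?_ ?_⟩
  · rw [Set.prod_univ]
    exact (coverEntropy_triMap_preimage_fst_le hf hg hmono {x}).trans
      (coverEntropy_singleton_le_zero f x)
  · simpa using coverEntropy_triMap_preimage_fst_le hf hg hmono Set.univ
  · have := coverEntropy_image_le_of_uniformContinuous (semiconj_fst_triMap f g)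
      uniformContinuous_fst Set.univ
    rwa [Set.image_univ, Set.range_eq_univ.2 Prod.fst_surjective] at this
end

section
/- Let T(x,y) = (f(x), g(x,y)) be a continuous triangular map on I × I whose basis map f is simple, i.e. every periodic point of f has minimal period a power of 2 (f has type at most 2^∞). Then h(T) = h_fib(T). -/
open Function Dynamics

/-- The unit interval `[0,1]`. -/
local notation "I" => unitInterval

/-! ### Counting itineraries in a transition system -/

/-- The sum of `φ` over the end points of all paths of length `n` starting at `J`, in the transition
system on `X` with letters in `ι` and transition map `st`. -/
def pathSum {X ι : Type*} [Fintype ι] (st : X → ι → X) (φ : X → ℕ) : ℕ → X → ℕ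
  | 0, J => φ J
  | n + 1, J => ∑ b, pathSum st φ n (st J b)

section PathSum

variable {X ι : Type*} [Fintype ι] {st : X → ι → X}

lemma pathSum_succ (φ : X → ℕ) (n : ℕ) (J : X) :
    pathSum st φ (n + 1) J = ∑ b, pathSum st φ n (st J b) := rfl

lemma pathSum_finset_sum {κ : Type*} (s : Finset κ) (φ : κ → X → ℕ) (n : ℕ) (J : X) :
    pathSum st (fun K => ∑ a ∈ s, φ a K) n J = ∑ a ∈ s, pathSum st (φ a) n J := by
  induction n generalizing J with
  | zero => rfl
  | succ n ih => simp only [pathSum_succ, ih]; exact Finset.sum_comm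

lemma pathSum_eq_zero {live : X → Prop} (hdead : ∀ J b, ¬ live J → ¬ live (st J b))
    {φ : X → ℕ} (hφ : ∀ J, ¬ live J → φ J = 0) (n : ℕ) {J : X} (hJ : ¬ live J) :
    pathSum st φ n J = 0 := by
  induction n generalizing J with
  | zero => exact hφ J hJ
  | succ n ih => exact Finset.sum_eq_zero fun b _ => ih (hdead J b hJ)

lemma pathSum_mul_pathSum_le [DecidableEq X] (K : X) (φ : X → ℕ) (m n : ℕ) (J : X) :
    pathSum st (fun L => if L = K then 1 else 0) m J * pathSum st φ n K ≤
      pathSum st φ (m + n) J := by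
  induction m generalizing J with
  | zero =>
    simp only [pathSum, zero_add]
    split_ifs with h
    · simp [h]
    · simp
  | succ m ih =>
    rw [Nat.succ_add, pathSum_succ, pathSum_succ, Finset.sum_mul]
    exact Finset.sum_le_sum fun b _ => ih _

lemma exists_foldl_eq_of_pathSum_pos [DecidableEq X] {K : X} {n : ℕ} {J : X}
    (h : 0 < pathSum st (fun L => if L = K then 1 else 0) n J) :
    ∃ w : List ι, w.length = n ∧ w.foldl st J = K := by
  induction n generalizing J with
  | zero =>
    refine ⟨[], rfl, ?_⟩
    by_contra hJ
    simp only [List.foldl_nil] at hJ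
    simp [pathSum, hJ] at h
  | succ n ih =>
    rw [pathSum_succ] at h
    obtain ⟨b, -, hb⟩ := Finset.exists_ne_zero_of_sum_ne_zero h.ne'
    obtain ⟨w, hw, hwK⟩ := ih (Nat.pos_of_ne_zero hb)
    exact ⟨b :: w, by simp [hw], hwK⟩

/-- More than `2 ^ n` paths of length `n` from `J` to `K` must contain two paths that separate
through non-adjacent letters. -/
lemma exists_separated_paths [DecidableEq X] {adj : ι → ι → Prop}
    (hadj : ∀ s : Finset ι, (∀ a ∈ s, ∀ b ∈ s, adj a b) → s.card ≤ 2)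
    {K : X} {n : ℕ} {J : X}
    (h : 2 ^ n < pathSum st (fun L => if L = K then 1 else 0) n J) :
    ∃ (u v v' : List ι) (b b' : ι), ¬ adj b b' ∧ v.length = v'.length ∧
      (u ++ b :: v).foldl st J = K ∧ (u ++ b' :: v').foldl st J = K := by
  induction n generalizing J with
  | zero =>
    simp only [pathSum] at h
    split_ifs at h <;> simp at h
  | succ n ih =>
    rw [pathSum_succ] at h
    set p : ι → ℕ := fun b => pathSum st (fun L => if L = K then 1 else 0) n (st J b) with hp
    by_cases hb : ∃ b, 2 ^ n < p b
    · obtain ⟨b, hb⟩ := hb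
      obtain ⟨u, v, v', c, c', h1, h2, h3, h4⟩ := ih hb
      exact ⟨b :: u, v, v', c, c', h1, h2, h3, h4⟩
    · push Not at hb
      have hs : ¬ ∀ a ∈ Finset.univ.filter (fun b => p b ≠ 0),
          ∀ b ∈ Finset.univ.filter (fun b => p b ≠ 0), adj a b := fun hs => by
        have h1 := hadj _ hs
        have h2 : ∑ b, p b ≤ (Finset.univ.filter (fun b => p b ≠ 0)).card * 2 ^ n := by
          rw [← Finset.sum_filter_ne_zero, ← smul_eq_mul]
          exact Finset.sum_le_card_nsmul _ _ _ fun b _ => hb b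
        have h3 := Nat.mul_le_mul_right (2 ^ n) h1
        have h4 : 2 ^ (n + 1) < ∑ b, p b := h
        rw [pow_succ] at h4
        omega
      push Not at hs
      obtain ⟨b, hb1, b', hb2, hbb⟩ := hs
      simp only [Finset.mem_filter, Finset.mem_univ, true_and] at hb1 hb2
      obtain ⟨v, hv, hvK⟩ := exists_foldl_eq_of_pathSum_pos (Nat.pos_of_ne_zero hb1)
      obtain ⟨v', hv', hvK'⟩ := exists_foldl_eq_of_pathSum_pos (Nat.pos_of_ne_zero hb2)
      exact ⟨[], v, v', b, b', hbb, hv.trans hv'.symm, hvK, hvK'⟩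

open Classical in
/-- Suppose that at most four live transitions out of any state do not lead to the state `A b` named
by their letter `b`, and that for `b ∉ bad` the number of paths starting at `A b` grows at rate at
most `8`. Then the number of all paths is controlled by the number of paths ending in the states
`A b` with `b ∈ bad`. -/
lemma pathSum_le_of_good {A : ι → X} {live : X → Prop}
    (hdead : ∀ J b, ¬ live J → ¬ live (st J b))
    (hfew : ∀ J, (Finset.univ.filter fun b => live (st J b) ∧ st J b ≠ A b).card ≤ 4)
    (bad : Finset ι)
    (hgood : ∀ b ∉ bad, ∃ C, ∀ n,
      pathSum st (fun L => if live L then 1 else 0) n (A b) ≤ C * 8 ^ n) :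
    ∃ C, ∀ n J, pathSum st (fun L => if live L then 1 else 0) n J ≤
      C * (∑ i ∈ Finset.range (n + 1),
        pathSum st (fun L => ∑ a ∈ bad, if L = A a then 1 else 0) i J * 8 ^ (n - i)) +
      C * 8 ^ n := by
  choose! C₀ hC₀ using hgood
  set N := pathSum st (fun L => if live L then 1 else 0) with hN
  set q : X → ℕ := fun L => ∑ a ∈ bad, if L = A a then 1 else 0 with hq
  set Q : ℕ → X → ℕ := fun n J =>
    ∑ i ∈ Finset.range (n + 1), pathSum st q i J * 8 ^ (n - i) with hQ
  have hQs : ∀ n J, Q (n + 1) J = (∑ b, Q n (st J b)) + q J * 8 ^ (n + 1) := by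
    intro n J
    simp only [hQ]
    rw [Finset.sum_range_succ', Finset.sum_comm]
    congr 1
    refine Finset.sum_congr rfl fun i _ => ?_
    rw [pathSum_succ, Finset.sum_mul, Nat.add_sub_add_right]
  set C := 1 + ∑ b, C₀ b with hC
  refine ⟨C, ?_⟩
  suffices key : ∀ n J, N n J ≤ C * Q n J + if 0 < q J then 0 else C * 8 ^ n by
    intro n J
    refine (key n J).trans ?_
    gcongr
    split_ifs <;> simp
  intro n
  induction n with
  | zero =>
    intro J
    have h1 : N 0 J ≤ 1 := by simp only [hN, pathSum]; split_ifs <;> simp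
    have h2 : Q 0 J = q J := by simp [hQ, pathSum]
    rw [h2]
    have h3 : 1 ≤ C := by omega
    split_ifs with h
    · have := Nat.mul_le_mul h3 h
      omega
    · omega
  | succ n ih =>
    intro J
    have hstep : ∀ b, N n (st J b) ≤ C * Q n (st J b) + C₀ b * 8 ^ n +
        if live (st J b) ∧ st J b ≠ A b then C * 8 ^ n else 0 := by
      intro b
      by_cases hl : live (st J b)
      · by_cases hA : st J b = A b
        · by_cases hb : b ∈ bad
          · have hqb : 0 < q (st J b) := by
              refine Finset.sum_pos' (fun _ _ => Nat.zero_le _) ⟨b, hb, by simp [hA]⟩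
            have := ih (st J b)
            rw [if_pos hqb] at this
            omega
          · have := hC₀ b hb n
            rw [← hA] at this
            omega
        · have := ih (st J b)
          rw [if_pos ⟨hl, hA⟩]
          split_ifs at this <;> omega
      · have : N n (st J b) = 0 :=
          pathSum_eq_zero hdead (fun J hJ => if_neg hJ) n hl
        omega
    have hsum : N (n + 1) J ≤ C * (∑ b, Q n (st J b)) + (∑ b, C₀ b) * 8 ^ n + 4 * (C * 8 ^ n) := by
      calc N (n + 1) J = ∑ b, N n (st J b) := rfl
        _ ≤ ∑ b, (C * Q n (st J b) + C₀ b * 8 ^ n +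
            if live (st J b) ∧ st J b ≠ A b then C * 8 ^ n else 0) :=
          Finset.sum_le_sum fun b _ => hstep b
        _ ≤ _ := by
          rw [Finset.sum_add_distrib, Finset.sum_add_distrib, Finset.mul_sum, Finset.sum_mul,
            ← Finset.sum_filter, Finset.sum_const, smul_eq_mul]
          gcongr
          exact hfew J
    have h5 : (∑ b, C₀ b) * 8 ^ n ≤ C * 8 ^ n := Nat.mul_le_mul_right _ (by omega)
    have h6 : N (n + 1) J ≤ C * (∑ b, Q n (st J b)) + C * 8 ^ (n + 1) := by
      have : C * 8 ^ (n + 1) = 8 * (C * 8 ^ n) := by ring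
      omega
    rw [hQs]
    split_ifs with h
    · have : C * 8 ^ (n + 1) ≤ C * (q J * 8 ^ (n + 1)) :=
        Nat.mul_le_mul_left _ (Nat.le_mul_of_pos_left _ h)
      rw [mul_add]
      omega
    · rw [mul_add]
      omega

open Classical in
/-- Either the number of paths grows at rate at most `8`, or for some state `A a` there are more
than `2 ^ n` loops of some length `n`. -/
lemma exists_loops_or_pathSum_le {A : ι → X} {live : X → Prop}
    (hdead : ∀ J b, ¬ live J → ¬ live (st J b))
    (hfew : ∀ J, (Finset.univ.filter fun b => live (st J b) ∧ st J b ≠ A b).card ≤ 4) :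
    (∃ a n, 2 ^ n < pathSum st (fun L => if L = A a then 1 else 0) n (A a)) ∨
    ∃ C, ∀ n J, pathSum st (fun L => if live L then 1 else 0) n J ≤ C * 8 ^ n := by
  by_cases hloop : ∃ a n, 2 ^ n < pathSum st (fun L => if L = A a then 1 else 0) n (A a)
  · exact Or.inl hloop
  right
  let R : ι → ι → Prop := fun b a =>
    ∃ n, 2 ^ n < pathSum st (fun L => if L = A b then 1 else 0) n (A a)
  have htrans : IsTrans ι R := ⟨fun c b a ⟨n, hn⟩ ⟨m, hm⟩ => ⟨m + n, by
    refine lt_of_lt_of_le ?_ (pathSum_mul_pathSum_le (A b) _ m n (A a))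
    rw [pow_add]
    exact Nat.mul_lt_mul'' hm hn⟩⟩
  have hirr : Std.Irrefl R := ⟨fun a ⟨n, hn⟩ => hloop ⟨a, n, hn⟩⟩
  have hwf : WellFounded R := Finite.wellFounded_of_trans_of_irrefl R
  have hgood : ∀ a, ∃ C, ∀ n,
      pathSum st (fun L => if live L then 1 else 0) n (A a) ≤ C * 8 ^ n := by
    intro a
    induction a using hwf.induction with
    | _ a ih =>
    obtain ⟨C, hC⟩ := pathSum_le_of_good hdead hfew (Finset.univ.filter fun b => ¬ R b a)
      (fun b hb => ih b (by simpa using hb))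
    refine ⟨C * (2 * Fintype.card ι) + C, fun n => (hC n (A a)).trans ?_⟩
    rw [add_mul, mul_assoc]
    gcongr
    have hterm : ∀ i ∈ Finset.range (n + 1), pathSum st (fun L => ∑ a ∈ (Finset.univ.filter
        fun b => ¬ R b a), if L = A a then 1 else 0) i (A a) * 8 ^ (n - i) ≤
        Fintype.card ι * (2 ^ i * 8 ^ (n - i)) := by
      intro i _
      rw [pathSum_finset_sum, ← mul_assoc]
      gcongr
      refine (Finset.sum_le_card_nsmul _ _ (2 ^ i) fun b hb => ?_).trans ?_
      · have := (Finset.mem_filter.1 hb).2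
        by_contra hlt
        exact this ⟨i, not_le.1 hlt⟩
      · rw [smul_eq_mul]
        gcongr
        exact Finset.card_le_univ _
    refine (Finset.sum_le_sum hterm).trans ?_
    rw [← Finset.mul_sum, mul_comm 2, mul_assoc]
    gcongr
    have hgeom : ∀ n : ℕ, ∑ i ∈ Finset.range (n + 1), 2 ^ i * 8 ^ (n - i) + 2 ^ n ≤ 2 * 8 ^ n := by
      intro n
      induction n with
      | zero => simp
      | succ n ihn =>
        rw [Finset.sum_range_succ]
        have : ∑ i ∈ Finset.range (n + 1), 2 ^ i * 8 ^ (n + 1 - i) =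
            8 * ∑ i ∈ Finset.range (n + 1), 2 ^ i * 8 ^ (n - i) := by
          rw [Finset.mul_sum]
          refine Finset.sum_congr rfl fun i hi => ?_
          rw [Nat.succ_sub (Nat.lt_succ_iff.1 (Finset.mem_range.1 hi)), pow_succ 8]
          ring
        rw [this, Nat.sub_self, pow_succ 2, pow_succ 8]
        omega
    exact (Nat.le_add_right _ _).trans (hgeom n)
  obtain ⟨C, hC⟩ := pathSum_le_of_good hdead hfew ∅ fun b _ => hgood b
  refine ⟨C, fun n J => (hC n J).trans ?_⟩
  have h0 : ∀ (i : ℕ) (K : X), pathSum st (fun _ => 0) i K = 0 := fun i => by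
    induction i with
    | zero => exact fun _ => rfl
    | succ i ihi => exact fun K => Finset.sum_eq_zero fun b _ => ihi _
  simp [h0]

end PathSum

/-! ### Covering relations between intervals -/

/-- The compact, possibly empty, subintervals of the unit interval. -/
abbrev CompactInterval : Type := {J : Set I // IsCompact J ∧ J.OrdConnected}

lemma ordConnected_image {g : I → I} (hg : Continuous g) {J : Set I} (hJ : J.OrdConnected) :
    (g '' J).OrdConnected :=
  (hJ.isPreconnected.image g hg.continuousOn).ordConnected

/-- The part of the image `g '' J` that lies in `A b`. -/
def imageInter {ι : Type*} {g : I → I} (hg : Continuous g) (A : ι → CompactInterval)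
    (J : CompactInterval) (b : ι) : CompactInterval :=
  ⟨g '' J ∩ A b, (J.2.1.image hg).inter (A b).2.1,
    (ordConnected_image hg J.2.2).inter (A b).2.2⟩

lemma exists_subinterval_mapsTo_uIcc {g : I → I} (hg : Continuous g) {s t : I} (hst : s ≤ t) :
    ∃ s' t', s ≤ s' ∧ s' ≤ t' ∧ t' ≤ t ∧ g s' = g s ∧ g t' = g t ∧
      ∀ x ∈ Set.Icc s' t', g x ∈ Set.uIcc (g s) (g t) := by
  have hc : ∀ c : I, IsClosed {x | g x = c} := fun c => isClosed_eq hg continuous_const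
  obtain ⟨s', ⟨⟨h1, h2⟩, h3⟩, h4⟩ :=
    (isCompact_Icc.inter_right (hc (g s))).exists_isGreatest
      (⟨s, ⟨le_rfl, hst⟩, rfl⟩ : (Set.Icc s t ∩ {x | g x = g s}).Nonempty)
  obtain ⟨t', ⟨⟨h5, h6⟩, h7⟩, h8⟩ :=
    (isCompact_Icc.inter_right (hc (g t))).exists_isLeast
      (⟨t, ⟨h2, le_rfl⟩, rfl⟩ : (Set.Icc s' t ∩ {x | g x = g t}).Nonempty)
  refine ⟨s', t', h1, h5, h6, h3, h7, fun x ⟨hx1, hx2⟩ => ?_⟩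
  simp only [Set.mem_ofPred_eq] at h3 h7
  by_contra hx
  have hcase : g s ∈ Set.uIcc (g x) (g t) ∨ g t ∈ Set.uIcc (g s) (g x) := by
    simp only [Set.mem_uIcc] at hx ⊢
    grind
  rcases hcase with h | h
  · rw [← h7] at h
    obtain ⟨y, hy, hgy⟩ := intermediate_value_uIcc hg.continuousOn h
    rw [Set.uIcc_of_le hx2] at hy
    have := h4 ⟨⟨h1.trans (hx1.trans hy.1), hy.2.trans h6⟩, hgy⟩
    have hxs : x = s' := le_antisymm (hy.1.trans this) hx1
    exact hx (by rw [hxs, h3]; exact Set.left_mem_uIcc)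
  · rw [← h3] at h
    obtain ⟨y, hy, hgy⟩ := intermediate_value_uIcc hg.continuousOn h
    rw [Set.uIcc_of_le hx1] at hy
    have := h8 ⟨⟨hy.1, hy.2.trans (hx2.trans h6)⟩, hgy⟩
    have hxs : x = t' := le_antisymm hx2 (this.trans hy.2)
    exact hx (by rw [hxs, h7]; exact Set.right_mem_uIcc)

lemma CompactInterval.eq_Icc (L : CompactInterval) (hL : (L : Set I).Nonempty) :
    ∃ c d, c ≤ d ∧ (L : Set I) = Set.Icc c d := by
  obtain ⟨c, hc⟩ := L.2.1.exists_isLeast hL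
  obtain ⟨d, hd⟩ := L.2.1.exists_isGreatest hL
  refine ⟨c, d, hc.2 hd.1, Set.Subset.antisymm (fun x hx => ⟨hc.2 hx, hd.2 hx⟩) ?_⟩
  have := L.2.2
  exact this.out hc.1 hd.1

lemma exists_subinterval_image_eq {g : I → I} (hg : Continuous g) {J L : CompactInterval}
    (h : (L : Set I) ⊆ g '' J) :
    ∃ K : CompactInterval, (K : Set I) ⊆ J ∧ g '' K = L := by
  rcases (L : Set I).eq_empty_or_nonempty with hL | hL
  · exact ⟨⟨∅, isCompact_empty, Set.ordConnected_empty⟩, Set.empty_subset _, by simp [hL]⟩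
  obtain ⟨c, d, hcd, hLcd⟩ := L.eq_Icc hL
  obtain ⟨x, hx, hxc⟩ := h (hLcd ▸ Set.left_mem_Icc.2 hcd : c ∈ (L : Set I))
  obtain ⟨y, hy, hyd⟩ := h (hLcd ▸ Set.right_mem_Icc.2 hcd : d ∈ (L : Set I))
  have key : ∀ s ∈ (J : Set I), ∀ t ∈ (J : Set I), s ≤ t → Set.uIcc (g s) (g t) = Set.Icc c d →
      ∃ K : CompactInterval, (K : Set I) ⊆ J ∧ g '' K = L := by
    intro s hs t ht hst hu
    obtain ⟨s', t', h1, h2, h3, h4, h5, h6⟩ := exists_subinterval_mapsTo_uIcc hg hst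
    have hJ := J.2.2
    refine ⟨⟨Set.Icc s' t', isCompact_Icc, Set.ordConnected_Icc⟩,
      (Set.Icc_subset_Icc h1 h3).trans (hJ.out hs ht), ?_⟩
    rw [hLcd, ← hu]
    refine Set.Subset.antisymm (Set.image_subset_iff.2 h6) ?_
    have := intermediate_value_uIcc (hg.continuousOn (s := Set.uIcc s' t'))
    rwa [h4, h5, Set.uIcc_of_le h2] at this
  rcases le_total x y with hxy | hxy
  · exact key x hx y hy hxy (by rw [hxc, hyd, Set.uIcc_of_le hcd])
  · exact key y hy x hx hxy (by rw [hxc, hyd, Set.uIcc_of_ge hcd])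

lemma exists_subinterval_of_foldl {ι : Type*} {g : I → I} (hg : Continuous g)
    {A : ι → CompactInterval} (w : List ι) {J L : CompactInterval}
    (h : (L : Set I) ⊆ (w.foldl (imageInter hg A) J : CompactInterval)) :
    ∃ K : CompactInterval, (K : Set I) ⊆ J ∧ g^[w.length] '' K = L ∧
      ∀ u b v, w = u ++ b :: v → Set.MapsTo g^[u.length + 1] K (A b) := by
  induction w generalizing J with
  | nil => exact ⟨L, h, by simp, by simp⟩
  | cons a w ih =>
    obtain ⟨K₁, h1, h2, h3⟩ := ih h
    have h1' : (K₁ : Set I) ⊆ g '' J ∩ A a := h1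
    obtain ⟨K, h4, h5⟩ := exists_subinterval_image_eq hg (h1'.trans Set.inter_subset_left)
    have h6 : Set.MapsTo g K K₁ := Set.image_subset_iff.1 h5.subset
    refine ⟨K, h4, ?_, ?_⟩
    · rw [List.length_cons, iterate_succ, Set.image_comp, h5, h2]
    · intro u b v huv
      rcases u with - | ⟨a', u⟩
      · obtain ⟨rfl, -⟩ := List.cons.inj huv
        exact fun x hx => (h1' (h6 hx)).2
      · obtain ⟨-, hw⟩ := List.cons.inj huv
        intro x hx
        exact h3 u b v hw (h6 hx)

lemma exists_isFixedPt_of_subset_image {F : I → I} (hF : Continuous F) {J : Set I}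
    (hJ : J.OrdConnected) (hne : J.Nonempty) (K : CompactInterval) (hK : (K : Set I) = F '' J)
    (h : J ⊆ F '' J) : ∃ x ∈ J, F x = x := by
  obtain ⟨c, d, hcd, hcK⟩ := K.eq_Icc (hK ▸ hne.image F)
  rw [hcK] at hK
  obtain ⟨s, hs, hsc⟩ : c ∈ F '' J := hK ▸ Set.left_mem_Icc.2 hcd
  obtain ⟨t, ht, htd⟩ : d ∈ F '' J := hK ▸ Set.right_mem_Icc.2 hcd
  have hs' : s ∈ Set.Icc c d := hK ▸ h hs
  have ht' : t ∈ Set.Icc c d := hK ▸ h ht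
  exact hJ.isPreconnected.intermediate_value₂ hs ht hF.continuousOn continuousOn_id
    (hsc.trans_le hs'.1) (ht'.2.trans_eq htd.symm)

/-- Two loops of the same length `n` at the same interval that separate through disjoint intervals
yield a point fixed by `g^[3 * n]` but not by `g^[n]`. -/
lemma exists_periodic_of_loops {ι : Type*} {g : I → I} (hg : Continuous g)
    {A : ι → CompactInterval} {J : CompactInterval} (hJ : (J : Set I).Nonempty)
    {u v v' : List ι} {b b' : ι} (hb : ¬ ((A b : Set I) ∩ A b').Nonempty)
    (hv : v.length = v'.length)
    (h : (u ++ b :: v).foldl (imageInter hg A) J = J)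
    (h' : (u ++ b' :: v').foldl (imageInter hg A) J = J) :
    ∃ n x, g^[3 * n] x = x ∧ g^[n] x ≠ x := by
  obtain ⟨K, h1, h2, h3⟩ := exists_subinterval_of_foldl hg (A := A) (J := J) (L := J)
    ((u ++ b :: v) ++ ((u ++ b' :: v') ++ (u ++ b' :: v'))) (by
      rw [List.foldl_append, h, List.foldl_append, h', h'])
  have hKne : (K : Set I).Nonempty := by
    rw [← h2] at hJ
    exact hJ.of_image
  obtain ⟨x, hx, hfix⟩ := exists_isFixedPt_of_subset_image (hg.iterate _) K.2.2 hKne J h2.symm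
    (h2 ▸ h1)
  refine ⟨(u ++ b :: v).length, x, ?_, fun hper => hb ?_⟩
  · convert hfix using 3
    simp only [List.length_append, List.length_cons, hv]
    omega
  · have e1 := h3 u b (v ++ ((u ++ b' :: v') ++ (u ++ b' :: v'))) (by simp) hx
    have e2 := h3 ((u ++ b :: v) ++ u) b' (v' ++ (u ++ b' :: v')) (by simp) hx
    rw [List.length_append, add_assoc, add_comm (u ++ b :: v).length, iterate_add_apply,
      hper] at e2
    exact ⟨_, e1, e2⟩

lemma card_imageInter_ne_le {ι : Type*} [Fintype ι] [DecidableEq CompactInterval] {g : I → I}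
    (hg : Continuous g) {A : ι → CompactInterval}
    (hadj : ∀ s : Finset ι, (∀ a ∈ s, ∀ b ∈ s, ((A a : Set I) ∩ A b).Nonempty) → s.card ≤ 2)
    [DecidablePred fun J : CompactInterval => (J : Set I).Nonempty] (J : CompactInterval) :
    (Finset.univ.filter fun b => ((imageInter hg A J b : CompactInterval) : Set I).Nonempty ∧
      imageInter hg A J b ≠ A b).card ≤ 4 := by
  classical
  rcases (J : Set I).eq_empty_or_nonempty with hJ | hJ
  · simp [imageInter, hJ]
  obtain ⟨c, d, hcd, hJcd⟩ := CompactInterval.eq_Icc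
    ⟨g '' J, J.2.1.image hg, ordConnected_image hg J.2.2⟩ (hJ.image g)
  have hcard : ∀ e : I, (Finset.univ.filter fun b => e ∈ (A b : Set I)).card ≤ 2 := fun e =>
    hadj _ fun a ha b hb => ⟨e, (Finset.mem_filter.1 ha).2, (Finset.mem_filter.1 hb).2⟩
  refine (Finset.card_le_card (t := (Finset.univ.filter fun b => c ∈ (A b : Set I)) ∪
    Finset.univ.filter fun b => d ∈ (A b : Set I)) fun b hb => ?_).trans
    ((Finset.card_union_le _ _).trans (Nat.add_le_add (hcard c) (hcard d)))
  simp only [Finset.mem_filter, Finset.mem_univ, true_and, Finset.mem_union] at hb ⊢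
  obtain ⟨⟨x, hx, hxA⟩, hne⟩ := hb
  by_contra! hcd'
  refine hne (Subtype.ext (Set.inter_eq_right.2 fun y hy => ?_))
  change g '' J = _ at hJcd
  rw [hJcd] at hx ⊢
  have hA := (A b).2.2
  constructor
  · by_contra hyc
    exact hcd'.1 (hA.out hy hxA ⟨(not_le.1 hyc).le, hx.1⟩)
  · by_contra hyd
    exact hcd'.2 (hA.out hxA hy ⟨hx.2, (not_le.1 hyd).le⟩)

lemma iterate_eq_of_iterate_three_mul {f : I → I}
    (hsimple : ∀ (x : I) (n : ℕ), MinPeriod f x n → ∃ k : ℕ, n = 2 ^ k) {n : ℕ} {x : I}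
    (h : f^[3 * n] x = x) : f^[n] x = x := by
  rcases Nat.eq_zero_or_pos n with rfl | hn
  · rfl
  have hper : IsPeriodicPt f (3 * n) x := h
  have hpos := hper.minimalPeriod_pos (by omega)
  obtain ⟨k, hk⟩ := hsimple x (minimalPeriod f x)
    ⟨hpos, isPeriodicPt_minimalPeriod f x,
      fun k hk hk' h => not_isPeriodicPt_of_pos_of_lt_minimalPeriod hk.ne' hk' h⟩
  have hdvd := hper.minimalPeriod_dvd
  rw [hk] at hdvd
  have hcop : Nat.Coprime (2 ^ k) 3 := Nat.Coprime.pow_left k (by norm_num)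
  have h2 : minimalPeriod f x ∣ n := hk ▸ hcop.dvd_of_dvd_mul_left hdvd
  exact (isPeriodicPt_minimalPeriod f x).trans_dvd h2

/-! ### Covers by sets that are small for a relation -/

/-- `F` is covered by at most `K` sets, any two points of `F` in the same set being related
by `R`. -/
def SmallCover {X : Type*} (F : Set X) (R : X → X → Prop) (K : ℝ) : Prop :=
  ∃ 𝒞 : Finset (Set X), (𝒞.card : ℝ) ≤ K ∧ F ⊆ ⋃ S ∈ 𝒞, S ∧
    ∀ S ∈ 𝒞, ∀ x ∈ S ∩ F, ∀ y ∈ S ∩ F, R x y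

namespace SmallCover

variable {X Y : Type*} {F : Set X} {R R' : X → X → Prop} {K K' : ℝ}

lemma mono {F' : Set X} (h : SmallCover F R K) (hF : F' ⊆ F)
    (hR : ∀ x ∈ F', ∀ y ∈ F', R x y → R' x y) (hK : K ≤ K') : SmallCover F' R' K' := by
  obtain ⟨𝒞, h1, h2, h3⟩ := h
  exact ⟨𝒞, h1.trans hK, hF.trans h2, fun S hS x hx y hy =>
    hR x hx.2 y hy.2 (h3 S hS x ⟨hx.1, hF hx.2⟩ y ⟨hy.1, hF hy.2⟩)⟩

lemma preimage {F : Set Y} {R : Y → Y → Prop} (h : SmallCover F R K) (φ : X → Y) :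
    SmallCover (φ ⁻¹' F) (fun x y => R (φ x) (φ y)) K := by
  classical
  obtain ⟨𝒞, h1, h2, h3⟩ := h
  refine ⟨𝒞.image (φ ⁻¹' ·), (Nat.cast_le.2 Finset.card_image_le).trans h1, fun x hx => ?_, ?_⟩
  · obtain ⟨S, hS, hxS⟩ := Set.mem_iUnion₂.1 (h2 hx)
    exact Set.mem_iUnion₂.2 ⟨_, Finset.mem_image_of_mem _ hS, hxS⟩
  · intro S hS x hx y hy
    obtain ⟨S, hS', rfl⟩ := Finset.mem_image.1 hS
    exact h3 S hS' _ hx _ hy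

lemma inter (h : SmallCover F R K) (h' : SmallCover F R' K') (hK : 0 ≤ K) :
    SmallCover F (fun x y => R x y ∧ R' x y) (K * K') := by
  classical
  obtain ⟨𝒞, h1, h2, h3⟩ := h
  obtain ⟨𝒟, k1, k2, k3⟩ := h'
  refine ⟨Finset.image₂ (· ∩ ·) 𝒞 𝒟, ?_, fun x hx => ?_, ?_⟩
  · refine (Nat.cast_le.2 (Finset.card_image₂_le _ _ _)).trans ?_
    rw [Nat.cast_mul]
    gcongr
  · obtain ⟨S, hS, hxS⟩ := Set.mem_iUnion₂.1 (h2 hx)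
    obtain ⟨S', hS', hxS'⟩ := Set.mem_iUnion₂.1 (k2 hx)
    exact Set.mem_iUnion₂.2 ⟨_, Finset.mem_image₂_of_mem hS hS', hxS, hxS'⟩
  · intro S₀ hS₀ x hx y hy
    obtain ⟨S, hS, S', hS', rfl⟩ := Finset.mem_image₂.1 hS₀
    exact ⟨h3 S hS x ⟨hx.1.1, hx.2⟩ y ⟨hy.1.1, hy.2⟩,
      k3 S' hS' x ⟨hx.1.2, hx.2⟩ y ⟨hy.1.2, hy.2⟩⟩

lemma biUnion {ι : Type*} {s : Finset ι} {G : ι → Set X} {K : ι → ℝ}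
    (h : ∀ i ∈ s, SmallCover (G i) R (K i)) :
    SmallCover (⋃ i ∈ s, G i) R (∑ i ∈ s, K i) := by
  classical
  choose! 𝒞 h1 h2 h3 using h
  refine ⟨s.biUnion fun i => (𝒞 i).image (· ∩ G i), ?_, fun x hx => ?_, ?_⟩
  · refine (Nat.cast_le.2 Finset.card_biUnion_le).trans ?_
    rw [Nat.cast_sum]
    exact Finset.sum_le_sum fun i hi => (Nat.cast_le.2 Finset.card_image_le).trans (h1 i hi)
  · obtain ⟨i, hi, hxi⟩ := Set.mem_iUnion₂.1 hx
    obtain ⟨S, hS, hxS⟩ := Set.mem_iUnion₂.1 (h2 i hi hxi)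
    exact Set.mem_iUnion₂.2 ⟨S ∩ G i,
      Finset.mem_biUnion.2 ⟨i, hi, Finset.mem_image_of_mem _ hS⟩, hxS, hxi⟩
  · intro S₀ hS₀ x hx y hy
    obtain ⟨i, hi, hSi⟩ := Finset.mem_biUnion.1 hS₀
    obtain ⟨S, hS, rfl⟩ := Finset.mem_image.1 hSi
    exact h3 i hi S hS x hx.1 y hy.1

lemma of_forall [DecidablePred (Set.Nonempty : Set X → Prop)]
    (h : ∀ x ∈ F, ∀ y ∈ F, R x y) : SmallCover F R (if F.Nonempty then 1 else 0) := by
  split_ifs with hF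
  · exact ⟨{F}, by simp, by simp, fun S hS x hx y hy => h x hx.2 y hy.2⟩
  · rw [Set.not_nonempty_iff_eq_empty.1 hF]
    exact ⟨∅, by simp, by simp, by simp⟩

end SmallCover

lemma smallCover_of_isDynCoverOf {X : Type*} {T : X → X} {F : Set X} {U V : SetRel X X} {n : ℕ}
    (hVU : ∀ x y z, (x, z) ∈ V → (y, z) ∈ V → (x, y) ∈ U) {s : Finset X}
    (h : IsDynCoverOf T F V n s) :
    SmallCover F (fun x y => ∀ i < n, (T^[i] x, T^[i] y) ∈ U) s.card := by
  classical
  refine ⟨s.image fun z => {x | (x, z) ∈ dynEntourage T V n},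
    Nat.cast_le.2 Finset.card_image_le, fun x hx => ?_, ?_⟩
  · obtain ⟨z, hz, hxz⟩ := h hx
    exact Set.mem_iUnion₂.2 ⟨_, Finset.mem_image_of_mem _ hz, hxz⟩
  · intro S hS x hx y hy i hi
    obtain ⟨z, -, rfl⟩ := Finset.mem_image.1 hS
    exact hVU _ _ _ (mem_dynEntourage.1 hx.1 i hi) (mem_dynEntourage.1 hy.1 i hi)

lemma SmallCover.coverMincard_le {X : Type*} {T : X → X} {F : Set X} {U : SetRel X X} {n : ℕ}
    {K : ℝ} (h : SmallCover F (fun x y => ∀ i < n, (T^[i] x, T^[i] y) ∈ U) K) :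
    ∃ k : ℕ, (k : ℝ) ≤ K ∧ coverMincard T F U n ≤ k := by
  classical
  obtain ⟨𝒞, h1, h2, h3⟩ := h
  rcases F.eq_empty_or_nonempty with rfl | ⟨x₀, -⟩
  · exact ⟨0, by simpa using (Nat.cast_nonneg _).trans h1, by simp⟩
  have : Nonempty X := ⟨x₀⟩
  choose! p hp using fun (S : Set X) (hS : (S ∩ F).Nonempty) => hS
  refine ⟨_, (Nat.cast_le.2 ((Finset.card_image_le (f := p)).trans
    (Finset.card_filter_le 𝒞 fun S => (S ∩ F).Nonempty))).trans h1,
    IsDynCoverOf.coverMincard_le_card fun x hx => ?_⟩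
  obtain ⟨S, hS, hxS⟩ := Set.mem_iUnion₂.1 (h2 hx)
  have hne : (S ∩ F).Nonempty := ⟨x, hxS, hx⟩
  exact ⟨p S, Finset.mem_coe.2 (Finset.mem_image_of_mem _ (Finset.mem_filter.2 ⟨hS, hne⟩)),
    mem_dynEntourage.2 (h3 S hS x ⟨hxS, hx⟩ _ (hp S hne))⟩

/-! ### Subexponential growth for simple interval maps -/

open Classical in
lemma smallCover_itineraries {ι : Type*} [Fintype ι] {g : I → I} (hg : Continuous g)
    {A : ι → CompactInterval} (hA : ∀ x, ∃ b, x ∈ (A b : Set I)) (n : ℕ) (J : CompactInterval) :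
    SmallCover (J : Set I)
      (fun x y => ∀ i < n, ∃ b, g^[i + 1] x ∈ (A b : Set I) ∧ g^[i + 1] y ∈ (A b : Set I))
      (pathSum (imageInter hg A)
        (fun L : CompactInterval => if (L : Set I).Nonempty then 1 else 0) n J : ℕ) := by
  induction n generalizing J with
  | zero =>
    have := SmallCover.of_forall (F := (J : Set I)) (R := fun x y => ∀ i < 0, ∃ b,
      g^[i + 1] x ∈ (A b : Set I) ∧ g^[i + 1] y ∈ (A b : Set I)) (by simp)
    simpa [pathSum] using this
  | succ n ih =>
    rw [pathSum_succ, Nat.cast_sum]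
    refine (SmallCover.biUnion (s := Finset.univ)
      (G := fun b => (J : Set I) ∩ g ⁻¹' (imageInter hg A J b : CompactInterval)) fun b _ =>
      ((ih (imageInter hg A J b)).preimage g).mono Set.inter_subset_right ?_ le_rfl).mono
      (fun x hx => ?_) (fun _ _ _ _ h => h) le_rfl
    · intro x hx y hy h i hi
      rcases i with - | i
      · exact ⟨b, hx.2.2, hy.2.2⟩
      · exact h i (by omega)
    · obtain ⟨b, hb⟩ := hA (g x)
      exact Set.mem_iUnion₂.2 ⟨b, Finset.mem_univ b, hx, ⟨x, hx, rfl⟩, hb⟩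

/-- The interval `[b / r, (b + 1) / r]`. -/
def gridInterval (r : ℕ) (b : Fin r) : CompactInterval :=
  ⟨{x | (b : ℝ) ≤ r * x ∧ r * (x : ℝ) ≤ b + 1}, by
    refine ⟨IsClosed.isCompact ?_, ⟨fun x hx y hy z hz => ?_⟩⟩
    · have hc : Continuous fun x : I => r * (x : ℝ) := by fun_prop
      exact (isClosed_le continuous_const hc).inter (isClosed_le hc continuous_const)
    · have h1 : (x : ℝ) ≤ z := hz.1
      have h2 : (z : ℝ) ≤ y := hz.2
      have h3 : (r : ℝ) * x ≤ r * z := by gcongr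
      have h4 : (r : ℝ) * z ≤ r * y := by gcongr
      exact ⟨hx.1.trans h3, h4.trans hy.2⟩⟩

lemma exists_mem_gridInterval {r : ℕ} (hr : 0 < r) (x : I) :
    ∃ b, x ∈ (gridInterval r b : Set I) := by
  have hr' : (0 : ℝ) < r := Nat.cast_pos.2 hr
  have hx0 : 0 ≤ r * (x : ℝ) := mul_nonneg hr'.le x.2.1
  have hx1 : r * (x : ℝ) ≤ r := mul_le_of_le_one_right hr'.le x.2.2
  rcases hx1.eq_or_lt with h | h
  · refine ⟨⟨r - 1, by omega⟩, ?_⟩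
    simp only [gridInterval, Set.mem_ofPred_eq, h]
    rw [Nat.cast_sub hr]
    constructor <;> simp
  · refine ⟨⟨⌊r * (x : ℝ)⌋₊, (Nat.floor_lt hx0).2 h⟩, Nat.floor_le hx0, (Nat.lt_floor_add_one _).le⟩

lemma card_le_two_of_gridInterval {r : ℕ} (s : Finset (Fin r))
    (hs : ∀ a ∈ s, ∀ b ∈ s, ((gridInterval r a : Set I) ∩ gridInterval r b).Nonempty) :
    s.card ≤ 2 := by
  rcases s.eq_empty_or_nonempty with rfl | hne
  · simp
  have hle : ∀ a ∈ s, ∀ b ∈ s, (a : ℕ) ≤ b + 1 := by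
    intro a ha b hb
    obtain ⟨x, hxa, hxb⟩ := hs a ha b hb
    exact_mod_cast hxa.1.trans hxb.2
  set m := s.min' hne with hm
  rw [← Finset.card_image_of_injective s Fin.val_injective]
  refine (Finset.card_le_card (t := {(m : ℕ), (m : ℕ) + 1}) fun i hi => ?_).trans Finset.card_le_two
  obtain ⟨a, ha, rfl⟩ := Finset.mem_image.1 hi
  have h1 := hle a ha m (s.min'_mem hne)
  have h2 : (m : ℕ) ≤ a := s.min'_le a ha
  simp only [Finset.mem_insert, Finset.mem_singleton]
  omega

lemma dist_le_of_mem_gridInterval {r : ℕ} (hr : 0 < r) {b : Fin r} {x y : I}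
    (hx : x ∈ (gridInterval r b : Set I)) (hy : y ∈ (gridInterval r b : Set I)) :
    dist x y ≤ 1 / r := by
  have hr' : (0 : ℝ) < r := Nat.cast_pos.2 hr
  rw [Subtype.dist_eq, Real.dist_eq, le_div_iff₀ hr']
  have h1 := hx.1
  have h2 := hx.2
  have h3 := hy.1
  have h4 := hy.2
  have : |(x : ℝ) - y| * r = |((x : ℝ) - y) * r| := by rw [abs_mul, abs_of_pos hr']
  rw [this, abs_le]
  constructor <;> nlinarith

lemma gridInterval_nonempty {r : ℕ} (b : Fin r) : (gridInterval r b : Set I).Nonempty := by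
  have hr' : (0 : ℝ) < r := Nat.cast_pos.2 b.pos
  have hb : (b : ℝ) ≤ r := Nat.cast_le.2 b.2.le
  refine ⟨⟨b / r, by positivity, (div_le_one hr').2 hb⟩, ?_⟩
  simp only [gridInterval, Set.mem_ofPred_eq, mul_div_cancel₀ _ hr'.ne']
  constructor <;> linarith

/-- The orbits of a simple interval map grow subexponentially. -/
lemma exists_smallCover_of_simple {f : I → I} (hf : Continuous f)
    (hsimple : ∀ (x : I) (n : ℕ), MinPeriod f x n → ∃ k : ℕ, n = 2 ^ k)
    {U : SetRel I I} (hU : U ∈ uniformity I) {η : ℝ} (hη : 0 < η) :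
    ∃ C : ℝ, ∀ n : ℕ, SmallCover (Set.univ : Set I)
      (fun x y => ∀ i < n, (f^[i] x, f^[i] y) ∈ U) (C * Real.exp (η * n)) := by
  classical
  obtain ⟨k, hk⟩ := exists_nat_gt (Real.log 8 / η)
  have hlog : 0 < Real.log 8 := Real.log_pos (by norm_num)
  have hk0 : 0 < k := Nat.cast_pos.1 ((div_pos hlog hη).trans hk)
  rw [div_lt_iff₀ hη] at hk
  have hg : Continuous f^[k] := hf.iterate k
  obtain ⟨ε, hε, hεU⟩ := Metric.mem_uniformity_dist.1
    (dynEntourage_mem_uniformity (CompactSpace.uniformContinuous_of_continuous hf) hU k)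
  obtain ⟨r, hr⟩ := exists_nat_one_div_lt hε
  have hcov := exists_mem_gridInterval (Nat.succ_pos r)
  rcases exists_loops_or_pathSum_le (st := imageInter hg (gridInterval (r + 1)))
    (A := gridInterval (r + 1)) (live := fun L : CompactInterval => (L : Set I).Nonempty)
    (fun J b hJ h => hJ (h.mono Set.inter_subset_left).of_image)
    (fun J => by
      convert card_imageInter_ne_le hg (card_le_two_of_gridInterval (r := r + 1)) J) with
    ⟨a, n, han⟩ | ⟨C, hC⟩
  · obtain ⟨u, v, v', b, b', hb, hv, h, h'⟩ := exists_separated_paths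
      (st := imageInter hg (gridInterval (r + 1))) (K := gridInterval (r + 1) a) (n := n)
      (J := gridInterval (r + 1) a)
      (adj := fun a b => ((gridInterval (r + 1) a : Set I) ∩ gridInterval (r + 1) b).Nonempty)
      card_le_two_of_gridInterval (by convert han)
    obtain ⟨l, x, hx, hne⟩ := exists_periodic_of_loops hg (gridInterval_nonempty a) hb hv h h'
    refine absurd ?_ hne
    rw [← iterate_mul] at hx ⊢
    exact iterate_eq_of_iterate_three_mul hsimple (by convert hx using 2; ring)
  refine ⟨∑ b : Fin (r + 1), (C : ℝ), fun n => ?_⟩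
  have h1 : ∀ b : Fin (r + 1), SmallCover (gridInterval (r + 1) b : Set I)
      (fun x y => ∀ i < n, (f^[i] x, f^[i] y) ∈ U) (C * Real.exp (η * n)) := by
    intro b
    refine (smallCover_itineraries hg hcov (n / k) (gridInterval (r + 1) b)).mono
      subset_rfl ?_ ?_
    · intro x hx y hy h i hi
      have hq : ∃ c, (f^[k])^[i / k] x ∈ (gridInterval (r + 1) c : Set I) ∧
          (f^[k])^[i / k] y ∈ (gridInterval (r + 1) c : Set I) := by
        rcases hik : i / k with - | q
        · exact ⟨b, hx, hy⟩
        · refine h q ?_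
          have := Nat.div_le_div_right (c := k) hi.le
          omega
      obtain ⟨c, hcx, hcy⟩ := hq
      have hd := (dist_le_of_mem_gridInterval (Nat.succ_pos r) hcx hcy).trans_lt
        (by exact_mod_cast hr)
      have := mem_dynEntourage.1 (hεU hd) (i % k) (Nat.mod_lt _ hk0)
      rwa [← iterate_mul, ← iterate_add_apply, ← iterate_add_apply, Nat.mod_add_div] at this
    · refine (Nat.cast_le.2 (hC (n / k) (gridInterval (r + 1) b))).trans ?_
      rw [Nat.cast_mul, Nat.cast_pow]
      gcongr
      rw [← Real.exp_log (show (0 : ℝ) < (8 : ℕ) by norm_num), ← Real.exp_nat_mul]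
      refine Real.exp_le_exp.2 ?_
      have h2 : ((n / k : ℕ) : ℝ) * k ≤ n := by exact_mod_cast Nat.div_mul_le_self n k
      calc ((n / k : ℕ) : ℝ) * Real.log (8 : ℕ) ≤ (n / k : ℕ) * (k * η) := by
            gcongr
            exact_mod_cast hk.le
        _ = η * ((n / k : ℕ) * k) := by ring
        _ ≤ η * n := by gcongr
  refine (SmallCover.biUnion (s := Finset.univ) fun b _ => h1 b).mono (fun x _ => ?_)
    (fun _ _ _ _ h => h) (Finset.sum_mul _ _ _).ge
  obtain ⟨b, hb⟩ := hcov x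
  exact Set.mem_iUnion₂.2 ⟨b, Finset.mem_univ b, hb⟩

/-! ### Entropy and fibers of a factor map -/

lemma smallCover_preimage_of_chain {X Y ι : Type*} {φ : X → Y} {T : X → X} {f : Y → Y}
    (hφ : Semiconj φ T f) {U : SetRel X X} {b : ℝ} (hb : 0 ≤ b) {O : ι → Set Y} {m : ι → ℕ} {M : ℕ}
    (hm : ∀ j, 0 < m j) (hM : ∀ j, m j ≤ M)
    (hO : ∀ j, SmallCover (φ ⁻¹' O j) (fun x y => ∀ i < m j, (T^[i] x, T^[i] y) ∈ U)
      (Real.exp (b * m j))) (n : ℕ) (B : Set Y) (hB : ∀ i < n, ∃ j, f^[i] '' B ⊆ O j) :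
    SmallCover (φ ⁻¹' B) (fun x y => ∀ i < n, (T^[i] x, T^[i] y) ∈ U)
      (Real.exp (b * (n + M))) := by
  classical
  induction n using Nat.strong_induction_on generalizing B with
  | _ n ih =>
  rcases Nat.eq_zero_or_pos n with rfl | hn
  · refine (SmallCover.of_forall (F := φ ⁻¹' B) (fun x _ y _ => by simp)).mono subset_rfl
      (fun _ _ _ _ h => h) ?_
    have : 1 ≤ Real.exp (b * ((0 : ℕ) + M)) := Real.one_le_exp (by positivity)
    split_ifs
    · exact this
    · exact zero_le_one.trans this
  obtain ⟨j, hj⟩ := hB 0 hn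
  rw [iterate_zero, Set.image_id] at hj
  have hfirst := (hO j).mono (F' := φ ⁻¹' B) (Set.preimage_mono hj)
    (fun _ _ _ _ h => h) le_rfl
  have hMj : (m j : ℝ) ≤ M := Nat.cast_le.2 (hM j)
  rcases le_total n (m j) with hnm | hnm
  · refine hfirst.mono subset_rfl (fun x _ y _ h i hi => h i (hi.trans_le hnm)) ?_
    gcongr
    exact hMj.trans (by simp)
  · have hrest := ((ih (n - m j) (by have := hm j; omega) (f^[m j] '' B) fun i hi => by
      obtain ⟨l, hl⟩ := hB (i + m j) (by omega)
      exact ⟨l, by rwa [← Set.image_comp, ← iterate_add]⟩).preimage T^[m j]).mono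
      (F' := φ ⁻¹' B) (fun x hx => ⟨φ x, hx, ((hφ.iterate_right (m j)).eq x).symm⟩)
      (fun _ _ _ _ h => h) le_rfl
    refine (hfirst.inter hrest (Real.exp_pos _).le).mono subset_rfl ?_ ?_
    · intro x _ y _ h i hi
      rcases lt_or_ge i (m j) with him | him
      · exact h.1 i him
      · have := h.2 (i - m j) (by omega)
        rwa [← iterate_add_apply, ← iterate_add_apply, Nat.sub_add_cancel him] at this
    · rw [← Real.exp_add, Nat.cast_sub hnm]
      apply le_of_eq
      ring_nf

lemma exists_open_smallCover {X Y : Type*} [UniformSpace X] [CompactSpace X] [TopologicalSpace Y]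
    [T2Space Y] {φ : X → Y} (hφ : Continuous φ) {T : X → X} (hT : Continuous T) {b : ℝ} {y : Y}
    (hy : coverEntropy T (φ ⁻¹' {y}) < b) {U : SetRel X X} (hU : U ∈ uniformity X) :
    ∃ (O : Set Y) (m : ℕ), IsOpen O ∧ y ∈ O ∧ 0 < m ∧
      SmallCover (φ ⁻¹' O) (fun x y => ∀ i < m, (T^[i] x, T^[i] y) ∈ U) (Real.exp (b * m)) := by
  classical
  obtain ⟨V, hV, hVo, hVs, hVU⟩ := comp_open_symm_mem_uniformity_sets hU
  have hlt := (coverEntropyEntourage_le_coverEntropy T (φ ⁻¹' {y}) hV).trans_lt hy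
  obtain ⟨m, hle, hm⟩ := ((ExpGrowth.eventually_le_exp hlt).and
    (Filter.eventually_gt_atTop 0)).exists
  obtain ⟨s, hs, hcard⟩ := (coverMincard_finite_iff T (φ ⁻¹' {y}) V m).1
    (coverMincard_finite_of_isCompact_uniformContinuous
      ((isClosed_singleton.preimage hφ).isCompact)
      (CompactSpace.uniformContinuous_of_continuous hT) hV m)
  set W : Set X := ⋃ z ∈ s, {x | (x, z) ∈ dynEntourage T V m} with hW
  have hWo : IsOpen W := isOpen_biUnion fun z _ =>
    (isOpen.dynEntourage hT hVo m).preimage (Continuous.prodMk_left z)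
  refine ⟨(φ '' Wᶜ)ᶜ, m, (hφ.isClosedMap _ hWo.isClosed_compl).isOpen_compl, ?_, hm, ?_⟩
  · rintro ⟨x, hx, hxy⟩
    obtain ⟨z, hz, hxz⟩ := hs (show x ∈ φ ⁻¹' {y} from hxy)
    exact hx (Set.mem_iUnion₂.2 ⟨z, hz, hxz⟩)
  · refine (smallCover_of_isDynCoverOf (U := U) (V := V) (s := s) (F := W) ?_ ?_).mono ?_
      (fun _ _ _ _ h => h) ?_
    · exact fun x y z hx hy => hVU ⟨z, hx, hVs.symm _ _ hy⟩
    · intro x hx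
      obtain ⟨z, hz, hxz⟩ := Set.mem_iUnion₂.1 hx
      exact ⟨z, hz, hxz⟩
    · intro x hx
      by_contra hxW
      exact hx ⟨x, hxW, rfl⟩
    · rw [← hcard, ← EReal.coe_coe_eq_natCast, ← EReal.coe_mul, EReal.exp_coe] at hle
      have h2 : ((s.card : ℕ∞) : ENNReal) = ENNReal.ofReal (s.card : ℝ) := by simp
      rw [h2] at hle
      exact (ENNReal.ofReal_le_ofReal_iff (Real.exp_pos _).le).1 hle

/-- If the orbits of the factor `f` grow subexponentially, then the entropy of `T` is carried by
the fibers of the factor map. -/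
theorem coverEntropy_le_iSup_fiber {X Y : Type*} [UniformSpace X] [CompactSpace X] [Nonempty X]
    [UniformSpace Y] [CompactSpace Y] [T2Space Y] {φ : X → Y} (hφc : Continuous φ)
    {T : X → X} (hT : Continuous T) {f : Y → Y} (hφ : Semiconj φ T f)
    (hf : ∀ U ∈ uniformity Y, ∀ η : ℝ, 0 < η → ∃ C : ℝ, ∀ n : ℕ, SmallCover (Set.univ : Set Y)
      (fun x y => ∀ i < n, (f^[i] x, f^[i] y) ∈ U) (C * Real.exp (η * n))) :
    coverEntropy T Set.univ ≤ ⨆ y, coverEntropy T (φ ⁻¹' {y}) := by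
  classical
  obtain ⟨x₀⟩ := ‹Nonempty X›
  refine EReal.le_of_forall_lt_iff_le.1 fun c hc => ?_
  obtain ⟨b, hαb, hbc⟩ := EReal.lt_iff_exists_real_btwn.1 hc
  rw [EReal.coe_lt_coe_iff] at hbc
  have hb : 0 ≤ b := by
    have h1 : (0 : EReal) ≤ coverEntropy T (φ ⁻¹' {φ x₀}) := coverEntropy_nonneg T ⟨x₀, rfl⟩
    have h2 := h1.trans ((le_iSup (fun y => coverEntropy T (φ ⁻¹' {y})) (φ x₀)).trans hαb.le)
    exact_mod_cast h2
  refine iSup₂_le fun U hU => ?_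
  choose O m hOo hyO hm hO using fun y => exists_open_smallCover hφc hT
    ((le_iSup (fun y => coverEntropy T (φ ⁻¹' {y})) y).trans_lt hαb) hU
  obtain ⟨t, ht⟩ := isCompact_univ.elim_finite_subcover O hOo
    fun y _ => Set.mem_iUnion.2 ⟨y, hyO y⟩
  obtain ⟨D, hD, hDO⟩ := lebesgue_number_lemma (U := fun j : t => O j) isCompact_univ
    (fun j => hOo j) (by simpa [Set.iUnion_subtype] using ht)
  set M := t.sup m with hM
  have hη : 0 < (c - b) / 2 := by linarith
  obtain ⟨C, hC⟩ := hf D hD _ hη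
  have htotal : ∀ n : ℕ, SmallCover (Set.univ : Set X)
      (fun x y => ∀ i < n, (T^[i] x, T^[i] y) ∈ U)
      (C * Real.exp ((c - b) / 2 * n) * Real.exp (b * (n + M))) := by
    intro n
    obtain ⟨𝒞, h1, h2, h3⟩ := hC n
    have hcell : ∀ S ∈ 𝒞, SmallCover (φ ⁻¹' S) (fun x y => ∀ i < n, (T^[i] x, T^[i] y) ∈ U)
        (Real.exp (b * (n + M))) := by
      intro S hS
      refine smallCover_preimage_of_chain hφ hb (O := fun j : t => O j) (m := fun j => m j)
        (fun j => hm j) (fun j => Finset.le_sup j.2) (fun j => hO j) n S fun i hi => ?_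
      rcases S.eq_empty_or_nonempty with rfl | ⟨x, hx⟩
      · obtain ⟨j, -⟩ := hDO (φ x₀) (Set.mem_univ _)
        exact ⟨j, by simp⟩
      · obtain ⟨j, hj⟩ := hDO (f^[i] x) (Set.mem_univ _)
        refine ⟨j, (Set.image_subset_iff.2 fun y hy => ?_).trans hj⟩
        exact h3 S hS x ⟨hx, Set.mem_univ _⟩ y ⟨hy, Set.mem_univ _⟩ i hi
    refine (SmallCover.biUnion hcell).mono (fun x _ => ?_) (fun _ _ _ _ h => h) ?_
    · obtain ⟨S, hS, hxS⟩ := Set.mem_iUnion₂.1 (h2 (Set.mem_univ (φ x)))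
      exact Set.mem_iUnion₂.2 ⟨S, hS, hxS⟩
    · rw [Finset.sum_const, nsmul_eq_mul]
      gcongr
  obtain ⟨N, hN⟩ := exists_nat_ge (C * Real.exp (b * M) / ((c - b) / 2))
  refine Eventually.expGrowthSup_le (Filter.eventually_atTop.2 ⟨N, fun n hn => ?_⟩)
  obtain ⟨k, hk, hcov⟩ := (htotal n).coverMincard_le
  have hkc : (k : ℝ) ≤ Real.exp (c * n) := by
    refine hk.trans ?_
    have h1 : C * Real.exp (b * M) ≤ Real.exp ((c - b) / 2 * n) := by
      rw [div_le_iff₀ hη] at hN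
      have h2 : (N : ℝ) * ((c - b) / 2) ≤ n * ((c - b) / 2) := by gcongr
      have h3 := Real.add_one_le_exp ((c - b) / 2 * n)
      linarith
    calc C * Real.exp ((c - b) / 2 * n) * Real.exp (b * (n + M))
        = (C * Real.exp (b * M)) * (Real.exp ((c - b) / 2 * n) * Real.exp (b * n)) := by
          rw [mul_add, Real.exp_add]
          ring
      _ ≤ Real.exp ((c - b) / 2 * n) * (Real.exp ((c - b) / 2 * n) * Real.exp (b * n)) := by
          gcongr
      _ = Real.exp (c * n) := by
          rw [← Real.exp_add, ← Real.exp_add]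
          ring_nf
  rw [← EReal.coe_coe_eq_natCast, ← EReal.coe_mul, EReal.exp_coe]
  refine (ENat.toENNReal_le.2 hcov).trans ?_
  have h2 : ((k : ℕ∞) : ENNReal) = ENNReal.ofReal (k : ℝ) := by simp
  rw [h2]
  exact ENNReal.ofReal_le_ofReal hkc

/-- If the basis map `f` is simple (every periodic point of `f` has minimal period a
power of `2`, i.e. `f` has type at most `2^∞`), then `h T = h_fib T`. -/
theorem triMap_entropy_of_simple_basis (f : I → I) (g : I × I → I)
    (hf : Continuous f) (hg : Continuous g)
    (hsimple : ∀ (x : I) (n : ℕ), MinPeriod f x n → ∃ k : ℕ, n = 2 ^ k) :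
    coverEntropy (triMap f g) Set.univ =
      ⨆ x : I, coverEntropy (triMap f g) ({x} ×ˢ (Set.univ : Set I)) := by
  apply le_antisymm
  · have h := coverEntropy_le_iSup_fiber (φ := Prod.fst) continuous_fst
      (T := triMap f g) ((hf.comp continuous_fst).prodMk hg) (f := f) (fun _ => rfl)
      (fun U hU η hη => exists_smallCover_of_simple hf hsimple hU hη)
    simpa only [Set.prod_univ] using h
  · exact iSup_le fun x => coverEntropy_monotone _ (Set.subset_univ _)
end
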